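/- arXiv:math/0409549 — 3 statements merged into one kernel-verified Lean document; each statement's English description precedes it below -/
import Mathlib

section
/- Let R be an archimedean valuation ring such that every finitely generated uniform R-module is generated by at most n elements, for some fixed positive integer n. Then R is an almost maximal valuation ring. -/
open IsLocalRing

universe u

/-- A chain (valuation) ring: ideals are totally ordered by inclusion. -/
def IsChainRing (R : Type u) [CommRing R] : Prop := ∀ I J : Ideal R, I ≤ J ∨ J ≤ I

/-- Archimedean: the maximal ideal is the only nonzero prime ideal. -/
def IsArchimedeanLocal (R : Type u) [CommRing R] [IsLocalRing R] : Prop :=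
  ∀ Q : Ideal R, Q.IsPrime → Q ≠ ⊥ → Q = maximalIdeal R

/-- The annihilator ideal `(0 : x)` of a module element. -/
def annOf (R : Type u) {M : Type u} [CommRing R] [AddCommGroup M] [Module R M] (x : M) :
    Ideal R := LinearMap.ker (LinearMap.toSpanSingleton R M x)

/-- fp-injective (absolutely pure): every homomorphism from a finitely generated
submodule of a finite free module extends; equivalently `Ext¹(F, M) = 0` for every
finitely presented `F`. -/
def IsFpInjective (R M : Type u) [CommRing R] [AddCommGroup M] [Module R M] : Prop :=
  ∀ (n : ℕ) (K : Submodule R (Fin n → R)), K.FG →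
    ∀ g : K →ₗ[R] M, ∃ h : (Fin n → R) →ₗ[R] M, ∀ x : K, h x = g x

/-- A coherent ring: every finitely generated ideal is finitely presented. -/
def IsCoherentRing (R : Type u) [CommRing R] : Prop :=
  ∀ I : Ideal R, I.FG → Module.FinitePresentation R ↥I

/-- An IF-ring: coherent and self fp-injective. -/
def IsIFRing (R : Type u) [CommRing R] : Prop := IsCoherentRing R ∧ IsFpInjective R R

/-- Purity of a submodule: `I·M ⊓ X = I·X` for every finitely generated ideal `I`. -/
def IsPureSubmodule {R M : Type u} [CommRing R] [AddCommGroup M] [Module R M]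
    (X : Submodule R M) : Prop :=
  ∀ I : Ideal R, I.FG → (I • (⊤ : Submodule R M)) ⊓ X = I • X

/-- A submodule is uniserial if its submodules are totally ordered by inclusion. -/
def IsUniserialSub {R M : Type u} [CommRing R] [AddCommGroup M] [Module R M]
    (U : Submodule R M) : Prop :=
  ∀ V W : Submodule R M, V ≤ U → W ≤ U → V ≤ W ∨ W ≤ V

/-- A uniserial module: submodules are totally ordered by inclusion. -/
def IsUniserialMod (R M : Type u) [CommRing R] [AddCommGroup M] [Module R M] : Prop :=
  ∀ V W : Submodule R M, V ≤ W ∨ W ≤ V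

/-- A faithful submodule: only `0` annihilates all its elements. -/
def IsFaithfulSub {R M : Type u} [CommRing R] [AddCommGroup M] [Module R M]
    (U : Submodule R M) : Prop := ∀ r : R, (∀ x ∈ U, r • x = 0) → r = 0

/-- A faithful module: its annihilator is zero. -/
def IsFaithfulMod (R M : Type u) [CommRing R] [AddCommGroup M] [Module R M] : Prop :=
  ∀ r : R, (∀ x : M, r • x = 0) → r = 0

/-- `μ(M)`: the minimal number of generators of a module. -/
noncomputable def mu (R M : Type u) [CommRing R] [AddCommGroup M] [Module R M] : ℕ :=
  sInf {n : ℕ | ∃ s : Finset M, s.card = n ∧ Submodule.span R (s : Set M) = ⊤}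

/-- A maximal ring: every family of cosets of ideals with the finite intersection
property has nonempty total intersection. -/
def IsMaximalRing (R : Type u) [CommRing R] : Prop :=
  ∀ (ι : Type u) (a : ι → R) (A : ι → Ideal R),
    (∀ s : Finset ι, ∃ x : R, ∀ i ∈ s, x - a i ∈ A i) → ∃ x : R, ∀ i, x - a i ∈ A i

/-- Almost maximal: `R/A` is maximal for every nonzero ideal `A`. -/
def IsAlmostMaximalRing (R : Type u) [CommRing R] : Prop :=
  ∀ A : Ideal R, A ≠ ⊥ → IsMaximalRing (R ⧸ A)

/-- A uniform module: any two nonzero submodules intersect nontrivially. -/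
def IsUniformMod (R M : Type u) [CommRing R] [AddCommGroup M] [Module R M] : Prop :=
  ∀ N₁ N₂ : Submodule R M, N₁ ≠ ⊥ → N₂ ≠ ⊥ → N₁ ⊓ N₂ ≠ ⊥

/-- Bounded module type with bound `n`: every finitely generated module is a direct
sum of submodules each generated by at most `n` elements. -/
def HasBoundedModuleType (R : Type u) [CommRing R] (n : ℕ) : Prop :=
  ∀ (M : Type u) [AddCommGroup M] [Module R M], Module.Finite R M →
    ∃ (ι : Type u) (N : ι → Submodule R M),
      iSupIndep N ∧ (⨆ i, N i) = ⊤ ∧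
      ∀ i, ∃ s : Finset M, s.card ≤ n ∧ Submodule.span R (s : Set M) = N i

section ChainRing

variable {R : Type u} [CommRing R]

/-- `t` and `s` generate each other's annihilator. -/
def IsAnnPair (t s : R) : Prop := (∀ x, t * x = 0 ↔ s ∣ x) ∧ ∀ x, s * x = 0 ↔ t ∣ x

theorem IsAnnPair.symm {t s : R} (h : IsAnnPair t s) : IsAnnPair s t := ⟨h.2, h.1⟩

theorem IsAnnPair.mul_eq_zero {t s : R} (h : IsAnnPair t s) : t * s = 0 := (h.1 s).2 dvd_rfl

/-- A chain ring, phrased elementwise, whose non-units are nilpotent and whose elements have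
principal annihilators. -/
structure IsNilCoherentChain (R : Type u) [CommRing R] : Prop where
  dvd_total : ∀ a b : R, a ∣ b ∨ b ∣ a
  nilpotent : ∀ p : R, ¬ IsUnit p → IsNilpotent p
  ann_principal : ∀ t : R, ∃ s, ∀ x, t * x = 0 ↔ s ∣ x

/-- Multiplying by powers of a nilpotent `p`, an element outside a submodule has a last multiple
outside. -/
theorem exists_notMem_mul_mem_of_isNilpotent {M : Type u} [AddCommGroup M] [Module R M]
    (S : Submodule R M) {x : M} (hx : x ∉ S) {p : R} (hp : IsNilpotent p) :
    ∃ q : R, q • x ∉ S ∧ (q * p) • x ∈ S := by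
  classical
  have h : ∃ N : ℕ, p ^ N • x ∈ S := by
    obtain ⟨N, hN⟩ := hp
    exact ⟨N, by simp [hN]⟩
  have h0 : Nat.find h ≠ 0 := fun h0 => hx (by simpa [h0] using Nat.find_spec h)
  obtain ⟨m, hm⟩ := Nat.exists_eq_succ_of_ne_zero h0
  refine ⟨p ^ m, Nat.find_min h (by omega), ?_⟩
  have := Nat.find_spec h
  rwa [hm, pow_succ] at this

theorem IsNilCoherentChain.exists_isAnnPair (hR : IsNilCoherentChain R) (t : R) : ∃ s, IsAnnPair t s := by
  obtain ⟨s, hs⟩ := hR.ann_principal t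
  have hts : t * s = 0 := (hs s).2 dvd_rfl
  refine ⟨s, hs, fun x => ⟨fun hx => ?_, ?_⟩⟩
  · by_contra htx
    obtain ⟨p, rfl⟩ : x ∣ t := (hR.dvd_total t x).resolve_left htx
    have hp : ¬ IsUnit p := fun hp => htx (hp.mul_right_dvd.2 dvd_rfl)
    have hx0 : x ∉ (⊥ : Submodule R R) := by
      intro h
      rw [Submodule.mem_bot] at h
      exact htx (by simp [h])
    obtain ⟨q, hq, hq'⟩ := exists_notMem_mul_mem_of_isNilpotent ⊥ hx0 (hR.nilpotent p hp)
    simp only [Submodule.mem_bot, smul_eq_mul] at hq hq'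
    obtain ⟨c, rfl⟩ := (hs q).1 (by linear_combination hq')
    exact hq (by linear_combination c * hx)
  · rintro ⟨c, rfl⟩
    linear_combination c * hts

/-- Elements annihilated by `t` are divisible by every generator of the annihilator of `t`, within
the submodule. -/
def IsAnnDivisible {M : Type u} [AddCommGroup M] [Module R M] (U : Submodule R M) : Prop :=
  ∀ t s : R, IsAnnPair t s → ∀ x ∈ U, t • x = 0 → ∃ y ∈ U, x = s • y

/-- Compatible sequences of congruences along an increasing sequence of principal ideals have a
common solution. -/
def IsSeqInjective (R M : Type u) [CommRing R] [AddCommGroup M] [Module R M] : Prop :=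
  ∀ (r : ℕ → R) (v : ℕ → M), (∀ i, r (i + 1) ∣ r i) → (∀ i, r i • (v (i + 1) - v i) = 0) →
    ∃ e : M, ∀ i, r i • (e - v i) = 0

section Injective

variable {E : Type u} [AddCommGroup E] [Module R E]

theorem Module.Injective.exists_smul_eq (hE : Module.Injective R E) {N : Type u} [AddCommGroup N]
    [Module R N] (φ : N →ₗ[R] R) (ψ : N →ₗ[R] E) (h : LinearMap.ker φ ≤ LinearMap.ker ψ) :
    ∃ e : E, ∀ x, φ x • e = ψ x := by
  have hinj : Function.Injective ((LinearMap.ker φ).liftQ φ le_rfl) :=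
    LinearMap.ker_eq_bot.1 (Submodule.ker_liftQ_eq_bot _ _ _ le_rfl)
  obtain ⟨g, hg⟩ := hE.out _ hinj ((LinearMap.ker φ).liftQ ψ h)
  refine ⟨g 1, fun x => ?_⟩
  have := hg (Submodule.Quotient.mk x)
  simp only [Submodule.liftQ_apply] at this
  rw [← this, ← map_smul, smul_eq_mul, mul_one]

theorem Module.Injective.isAnnDivisible (hE : Module.Injective R E) :
    IsAnnDivisible (⊤ : Submodule R E) := by
  intro t s hts x _ hx
  obtain ⟨e, he⟩ := hE.exists_smul_eq (LinearMap.toSpanSingleton R R s)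
    (LinearMap.toSpanSingleton R E x) (by
      intro c hc
      simp only [LinearMap.mem_ker, LinearMap.toSpanSingleton_apply, smul_eq_mul] at hc ⊢
      obtain ⟨d, rfl⟩ := (hts.2 c).1 (by rw [mul_comm, hc])
      rw [mul_comm, mul_smul, hx, smul_zero])
  exact ⟨e, trivial, by simpa using (he 1).symm⟩

theorem Module.Injective.isSeqInjective (hE : Module.Injective R E) : IsSeqInjective R E := by
  intro r v hr hv
  have hdvd : ∀ i k, r (i + k) ∣ r i := by
    intro i k
    induction k with
    | zero => exact dvd_rfl
    | succ k ih => exact (hr (i + k)).trans ih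
  have hstep : ∀ i k, r i • v i = r i • v (i + k) := by
    intro i k
    induction k with
    | zero => rfl
    | succ k ih =>
      obtain ⟨c, hc⟩ := hdvd i k
      have := hv (i + k)
      rw [smul_sub, sub_eq_zero] at this
      rw [ih, hc, mul_comm, mul_smul, mul_smul, ← add_assoc, this]
  obtain ⟨e, he⟩ := hE.exists_smul_eq (Finsupp.lsum R fun i => LinearMap.toSpanSingleton R R (r i))
    (Finsupp.lsum R fun i : ℕ => LinearMap.toSpanSingleton R E (r i • v i)) (by
      intro c hc
      rw [LinearMap.mem_ker] at hc ⊢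
      rw [Finsupp.lsum_apply, Finsupp.sum] at hc ⊢
      simp only [LinearMap.toSpanSingleton_apply] at hc ⊢
      set K := c.support.sup id
      have : ∀ i ∈ c.support, c i • r i • v i = (c i • r i) • v K := by
        intro i hi
        obtain ⟨k, hk⟩ := Nat.exists_eq_add_of_le (show i ≤ K from Finset.le_sup (f := id) hi)
        rw [hk, smul_assoc, ← hstep]
      rw [Finset.sum_congr rfl this, ← Finset.sum_smul, hc, zero_smul])
  refine ⟨e, fun i => ?_⟩
  have := he (Finsupp.single i 1)
  simp only [Finsupp.lsum_single, LinearMap.toSpanSingleton_apply, one_smul] at this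
  rw [smul_sub, this, sub_self]

theorem exists_injective_uniform [Nontrivial R] (hc : ∀ a b : R, a ∣ b ∨ b ∣ a) :
    ∃ (E : Type u) (_ : AddCommGroup E) (_ : Module R E),
      Module.Injective R E ∧ IsUniformMod R E ∧ Nontrivial E := by
  let J := CharacterModule R
  have hJ : Module.Injective R J :=
    Module.Baer.injective (Module.Flat.iff_characterModule_baer.1 inferInstance)
  let S : Set (Submodule R J) :=
    {N | ∀ x ∈ N, ∀ y ∈ N, x ≠ 0 → y ≠ 0 → ∃ a b : R, a • x = b • y ∧ a • x ≠ 0}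
  obtain ⟨j, hj⟩ : ∃ j : J, j ≠ 0 := by
    by_contra! h
    exact one_ne_zero (CharacterModule.eq_zero_of_character_apply (A := R) (a := 1)
      fun c => by rw [h c]; rfl)
  have hjS : Submodule.span R {j} ∈ S := by
    intro x hx y hy hx0 hy0
    obtain ⟨a, rfl⟩ := Submodule.mem_span_singleton.1 hx
    obtain ⟨b, rfl⟩ := Submodule.mem_span_singleton.1 hy
    rcases hc a b with ⟨c, rfl⟩ | ⟨c, rfl⟩
    · exact ⟨c, 1, by rw [one_smul, mul_comm, mul_smul],
        by rwa [mul_comm, mul_smul] at hy0⟩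
    · exact ⟨1, c, by rw [one_smul, mul_comm, mul_smul], by rwa [one_smul]⟩
  obtain ⟨E, hjE, hE⟩ := zorn_le_nonempty₀ S (by
    intro C hCS hC N hN
    refine ⟨sSup C, ?_, fun z hz => le_sSup hz⟩
    intro x hx y hy
    rw [Submodule.mem_sSup_of_directed ⟨N, hN⟩ hC.directedOn] at hx hy
    obtain ⟨A, hA, hx⟩ := hx
    obtain ⟨B, hB, hy⟩ := hy
    rcases hC.total hA hB with h | h
    · exact hCS hB x (h hx) y hy
    · exact hCS hA x hx y (h hy)) _ hjS
  obtain ⟨X, -, hX⟩ := zorn_le_nonempty₀ {X : Submodule R J | Disjoint X E} (by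
    intro C hCS hC N hN
    refine ⟨sSup C, ?_, fun z hz => le_sSup hz⟩
    rw [Set.mem_ofPred_eq, Submodule.disjoint_def]
    intro x hx hxE
    rw [Submodule.mem_sSup_of_directed ⟨N, hN⟩ hC.directedOn] at hx
    obtain ⟨A, hA, hx⟩ := hx
    exact Submodule.disjoint_def.1 (hCS hA) x hx hxE) ⊥ disjoint_bot_left
  have hXE := Submodule.disjoint_def.1 hX.prop
  have hess : ∀ x : J, x ∉ X → ∃ a : R, ∃ e ∈ E, e ≠ 0 ∧ a • x - e ∈ X := by
    intro x hx
    by_contra! h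
    have hd : Disjoint (X ⊔ Submodule.span R {x}) E := by
      rw [Submodule.disjoint_def]
      intro y hy hyE
      obtain ⟨z, hz, w, hw, rfl⟩ := Submodule.mem_sup.1 hy
      obtain ⟨a, rfl⟩ := Submodule.mem_span_singleton.1 hw
      by_contra h0
      refine h a _ hyE h0 ?_
      have : a • x - (z + a • x) = -z := by abel
      rw [this]
      exact X.neg_mem hz
    have hle := hX.le_of_ge hd le_sup_left
    exact hx (hle (Submodule.mem_sup_right (Submodule.mem_span_singleton_self x)))
  have hι : Function.Injective (X.mkQ ∘ₗ E.subtype) := by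
    rw [← LinearMap.ker_eq_bot, LinearMap.ker_eq_bot']
    intro m hm
    have : (m : J) ∈ X := by simpa using hm
    exact Subtype.ext (hXE _ this m.2)
  obtain ⟨φ, hφ⟩ := hJ.out _ hι E.subtype
  have hφ' : ∀ e ∈ E, φ (X.mkQ e) = e := fun e he => hφ ⟨e, he⟩
  have hmk : ∀ a : R, ∀ x e : J, a • x - e ∈ X → a • X.mkQ x = X.mkQ e := by
    intro a x e h
    rw [← sub_eq_zero, ← map_smul, ← map_sub]
    exact (Submodule.Quotient.mk_eq_zero X).2 h
  have hran : LinearMap.range φ ∈ S := by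
    rintro _ ⟨x, rfl⟩ _ ⟨y, rfl⟩ hx hy
    obtain ⟨x, rfl⟩ := X.mkQ_surjective x
    obtain ⟨y, rfl⟩ := X.mkQ_surjective y
    have hx' : x ∉ X := fun h => hx (by
      rw [(LinearMap.mem_ker.1 (by rwa [Submodule.ker_mkQ]) : X.mkQ x = 0), map_zero])
    have hy' : y ∉ X := fun h => hy (by
      rw [(LinearMap.mem_ker.1 (by rwa [Submodule.ker_mkQ]) : X.mkQ y = 0), map_zero])
    obtain ⟨a, e, he, he0, hae⟩ := hess x hx'
    obtain ⟨b, f, hf, hf0, hbf⟩ := hess y hy'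
    obtain ⟨c, d, hcd, hcd0⟩ := hE.prop e he f hf he0 hf0
    have h1 : (c * a) • φ (X.mkQ x) = c • e := by
      rw [mul_smul, ← map_smul, hmk a x e hae, hφ' e he]
    have h2 : (d * b) • φ (X.mkQ y) = d • f := by
      rw [mul_smul, ← map_smul, hmk b y f hbf, hφ' f hf]
    exact ⟨c * a, d * b, by rw [h1, h2, hcd], by rwa [h1]⟩
  have hrE : LinearMap.range φ ≤ E :=
    hE.le_of_ge hran fun e he => ⟨X.mkQ e, hφ' e he⟩
  let ρ : J →ₗ[R] E := (φ ∘ₗ X.mkQ).codRestrict E fun x => hrE ⟨_, rfl⟩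
  refine ⟨E, inferInstance, inferInstance, ⟨?_⟩, ?_, ?_⟩
  · intro A B _ _ _ _ f hf g
    obtain ⟨h, hh⟩ := hJ.out f hf (E.subtype ∘ₗ g)
    refine ⟨ρ ∘ₗ h, fun x => Subtype.ext ?_⟩
    simp only [LinearMap.comp_apply, hh]
    exact hφ' _ (g x).2
  · intro N₁ N₂ h₁ h₂
    obtain ⟨x, hx, hx0⟩ := N₁.exists_mem_ne_zero_of_ne_bot h₁
    obtain ⟨y, hy, hy0⟩ := N₂.exists_mem_ne_zero_of_ne_bot h₂
    obtain ⟨a, b, hab, h0⟩ := hE.prop x x.2 y y.2 (by simpa using hx0) (by simpa using hy0)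
    have hab' : a • x = b • y := Subtype.ext hab
    refine (Submodule.ne_bot_iff _).2 ⟨a • x, ⟨N₁.smul_mem a hx, ?_⟩, fun h => h0 ?_⟩
    · rw [hab']
      exact N₂.smul_mem b hy
    · simpa using congrArg Subtype.val h
  · exact ⟨⟨⟨j, hjE (Submodule.mem_span_singleton_self j)⟩, 0,
      fun h => hj (by simpa using congrArg Subtype.val h)⟩⟩

end Injective

section AnnDivisible

variable {M : Type u} [AddCommGroup M] [Module R M]

theorem isAnnDivisible_bot : IsAnnDivisible (⊥ : Submodule R M) := by
  rintro t s - x hx -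
  exact ⟨0, zero_mem _, by simpa using hx⟩

theorem IsAnnDivisible.exists_smul_eq_of_mem {U : Submodule R M} (hU : IsAnnDivisible U)
    {p s : R} (hp : IsAnnPair p s) {x : M} (hx : p • x ∈ U) : ∃ u ∈ U, p • x = p • u :=
  hU s p hp.symm _ hx (by rw [smul_smul, mul_comm, hp.mul_eq_zero, zero_smul])

theorem IsAnnDivisible.quotient (hM : IsAnnDivisible (⊤ : Submodule R M)) {U : Submodule R M}
    (hU : IsAnnDivisible U) : IsAnnDivisible (⊤ : Submodule R (M ⧸ U)) := by
  intro t s hts x _ hx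
  obtain ⟨x, rfl⟩ := U.mkQ_surjective x
  rw [← map_smul, Submodule.mkQ_apply, Submodule.Quotient.mk_eq_zero] at hx
  obtain ⟨u, hu, hxu⟩ := hU.exists_smul_eq_of_mem hts hx
  obtain ⟨y, -, hy⟩ := hM t s hts (x - u) trivial (by rw [smul_sub, hxu, sub_self])
  refine ⟨U.mkQ y, trivial, ?_⟩
  rw [← map_smul, ← hy, map_sub, (by exact (Submodule.Quotient.mk_eq_zero U).2 hu :
    U.mkQ u = 0), sub_zero]

theorem IsAnnDivisible.comap_mkQ {U : Submodule R M} (hU : IsAnnDivisible U)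
    {W : Submodule R (M ⧸ U)} (hW : IsAnnDivisible W) :
    IsAnnDivisible (W.comap U.mkQ) := by
  intro t s hts x hx htx
  obtain ⟨w, hw, hxw⟩ := hW t s hts _ hx (by rw [← map_smul, htx, map_zero])
  obtain ⟨w, rfl⟩ := U.mkQ_surjective w
  have hmem : x - s • w ∈ U := by
    rw [← Submodule.Quotient.mk_eq_zero, ← Submodule.mkQ_apply, map_sub, hxw, map_smul, sub_self]
  obtain ⟨u, hu, hxu⟩ := hU t s hts _ hmem (by
    rw [smul_sub, htx, smul_smul, hts.mul_eq_zero, zero_smul, sub_zero])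
  refine ⟨u + w, ?_, by rw [smul_add, ← hxu, sub_add_cancel]⟩
  rw [Submodule.mem_comap, map_add, (by exact (Submodule.Quotient.mk_eq_zero U).2 hu :
    U.mkQ u = 0), zero_add]
  exact hw

theorem IsSeqInjective.quotient (hR : IsNilCoherentChain R) (hM : IsSeqInjective R M)
    {U : Submodule R M} (hU : IsAnnDivisible U) : IsSeqInjective R (M ⧸ U) := by
  intro r v hr hv
  choose w hw using fun i => U.mkQ_surjective (v i)
  have hmem : ∀ i, r i • (w (i + 1) - w i) ∈ U := by
    intro i
    rw [← Submodule.Quotient.mk_eq_zero, ← Submodule.mkQ_apply, map_smul, map_sub, hw, hw, hv]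
  have hex : ∀ i, ∃ u ∈ U, r i • (w (i + 1) - w i) = r i • u := fun i =>
    hU.exists_smul_eq_of_mem (hR.exists_isAnnPair (r i)).choose_spec (hmem i)
  choose u hu hwu using hex
  have hmk : ∀ x ∈ U, U.mkQ x = 0 := fun x hx => (Submodule.Quotient.mk_eq_zero U).2 hx
  obtain ⟨e, he⟩ := hM r (fun i => w i - ∑ j ∈ Finset.range i, u j) hr (fun i => by
    have : w (i + 1) - ∑ j ∈ Finset.range (i + 1), u j - (w i - ∑ j ∈ Finset.range i, u j) =
      (w (i + 1) - w i) - u i := by rw [Finset.sum_range_succ]; abel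
    rw [this, smul_sub, hwu, sub_self])
  refine ⟨U.mkQ e, fun i => ?_⟩
  have := congrArg U.mkQ (he i)
  rwa [map_smul, map_sub, map_sub, hmk (∑ j ∈ Finset.range i, u j)
    (Submodule.sum_mem _ fun j _ => hu j), sub_zero, hw, map_zero] at this

/-- Elements of `U'` can be chosen with arbitrarily small order ideal modulo `U`. -/
theorem IsAnnDivisible.exists_forall_dvd (hR : IsNilCoherentChain R) {U U' : Submodule R M}
    (hU : IsAnnDivisible U) (hU' : IsAnnDivisible U') (hlt : U < U') {b b' : R}
    (hb : ¬ IsUnit b) (hbb : IsAnnPair b b') :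
    ∃ y ∈ U', ∀ c : R, c • y ∈ U → b' ∣ c := by
  obtain ⟨x, hx', hx⟩ := SetLike.exists_of_lt hlt
  obtain ⟨q, hq, hqb⟩ := exists_notMem_mul_mem_of_isNilpotent U hx (hR.nilpotent b hb)
  obtain ⟨p', hp⟩ := hR.exists_isAnnPair (q * b)
  obtain ⟨u, hu, hxu⟩ := hU.exists_smul_eq_of_mem hp hqb
  obtain ⟨y, hy, hxy⟩ := hU' _ _ hp (x - u) (U'.sub_mem hx' (hlt.le hu))
    (by rw [smul_sub, hxu, sub_self])
  have hiff : ∀ d : R, (d * p') • y ∈ U → d • x ∈ U := by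
    intro d hd
    rw [mul_smul, ← hxy, smul_sub] at hd
    simpa using U.add_mem hd (U.smul_mem d hu)
  refine ⟨y, hy, fun c hc => ?_⟩
  rcases hR.dvd_total p' c with ⟨d, rfl⟩ | ⟨d, rfl⟩
  · have hd : d • x ∈ U := hiff d (by rwa [mul_comm])
    obtain ⟨h, rfl⟩ : q ∣ d := by
      refine (hR.dvd_total q d).resolve_right ?_
      rintro ⟨h, rfl⟩
      exact hq (by rw [mul_comm, mul_smul]; exact U.smul_mem h hd)
    exact (hbb.1 _).1 (by linear_combination h * hp.mul_eq_zero)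
  · exact absurd (by
      simpa using hiff 1 (by rw [one_mul, mul_comm, mul_smul]; exact U.smul_mem d hc)) hx

/-- `U` contains `k` elements which, modulo any prescribed proper multiple of `U`, satisfy only
relations with non-unit coefficients. -/
def HasIndependentFamily (k : ℕ) (U : Submodule R M) : Prop :=
  ∀ q : R, ¬ IsUnit q → ∃ x : Fin k → M, (∀ i, x i ∈ U) ∧
    ∀ c : Fin k → R, (∃ u ∈ U, ∑ i, c i • x i = q • u) → ∀ i, ¬ IsUnit (c i)

theorem hasIndependentFamily_zero (U : Submodule R M) : HasIndependentFamily 0 U :=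
  fun _ _ => ⟨Fin.elim0, fun i => i.elim0, fun _ _ i => i.elim0⟩

theorem HasIndependentFamily.succ (hR : IsNilCoherentChain R)
    (hP : ∀ q : R, ¬ IsUnit q → ∃ p : R, ¬ IsUnit p ∧ ¬ q ∣ p) {k : ℕ} {U U' : Submodule R M}
    (hk : HasIndependentFamily k U) (hU : IsAnnDivisible U) (hU' : IsAnnDivisible U')
    (hlt : U < U') : HasIndependentFamily (k + 1) U' := by
  intro q hq
  obtain ⟨p, hp, hqp⟩ := hP q hq
  have hpq : p ∣ q := (hR.dvd_total q p).resolve_left hqp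
  obtain ⟨q', hqq⟩ := hR.exists_isAnnPair q
  have hne : q' * p ≠ 0 := fun h => hqp ((hqq.2 p).1 h)
  obtain ⟨b, hb⟩ := hR.exists_isAnnPair (q' * p)
  have hbu : ¬ IsUnit b := fun h => hne (h.mul_left_eq_zero.1 hb.mul_eq_zero)
  obtain ⟨y, hy, hyc⟩ := hU.exists_forall_dvd hR hU' hlt hbu hb.symm
  obtain ⟨x, hx, hxc⟩ := hk p hp
  refine ⟨Fin.cons y x, fun i => ?_, fun c => ?_⟩
  · refine Fin.cases ?_ (fun i => ?_) i
    · simpa using hy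
    · simpa using hlt.le (hx i)
  · rintro ⟨g, hg, hsum⟩
    rw [Fin.sum_univ_succ] at hsum
    simp only [Fin.cons_zero, Fin.cons_succ] at hsum
    have hmem : ∑ i : Fin k, c i.succ • x i ∈ U := U.sum_mem fun i _ => U.smul_mem _ (hx i)
    have hpc : p ∣ c 0 := by
      obtain ⟨h, hh⟩ := hyc (q' * c 0) (by
        have h1 : (q' * c 0) • y = -(q' • ∑ i : Fin k, c i.succ • x i) := by
          rw [eq_neg_iff_add_eq_zero, mul_smul, ← smul_add, hsum, smul_smul,
            mul_comm, hqq.mul_eq_zero, zero_smul]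
        rw [h1]
        exact U.neg_mem (U.smul_mem _ hmem))
      have hq0 : q ∣ c 0 - p * h := (hqq.2 _).1 (by linear_combination hh)
      have := (hpq.trans hq0).add (Dvd.intro h rfl)
      rwa [sub_add_cancel] at this
    obtain ⟨d, hd⟩ := hpc
    obtain ⟨f, rfl⟩ := hpq
    have hdiv : ∑ i : Fin k, c i.succ • x i = p • (f • g - d • y) := by
      rw [smul_sub, smul_smul, smul_smul, ← hsum, hd]
      abel
    obtain ⟨u, hu, hpu⟩ := hU.exists_smul_eq_of_mem
      (hR.exists_isAnnPair p).choose_spec (x := f • g - d • y) (by rwa [← hdiv])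
    have hind := hxc (fun i => c i.succ) ⟨u, hu, by rw [hdiv, hpu]⟩
    intro i
    refine Fin.cases ?_ (fun i => hind i) i
    rw [hd]
    exact fun h => hp (isUnit_of_mul_isUnit_left h)

theorem le_of_linearIndependent_mod_nonunits [IsLocalRing R] {k n : ℕ} (x : Fin k → M)
    (hx : ∀ c : Fin k → R, ∑ i, c i • x i = 0 → ∀ i, ¬ IsUnit (c i))
    (hn : ∃ s : Finset (Submodule.span R (Set.range x)), s.card ≤ n ∧
      Submodule.span R (s : Set (Submodule.span R (Set.range x))) = ⊤) : k ≤ n := by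
  classical
  obtain ⟨s, hs, htop⟩ := hn
  let π : (Fin k → R) →ₗ[R] Submodule.span R (Set.range x) :=
    (Fintype.linearCombination R x).codRestrict _ (fun c => by
      rw [Fintype.linearCombination_apply]
      exact Submodule.sum_mem _ fun i _ => Submodule.smul_mem _ _
        (Submodule.subset_span ⟨i, rfl⟩))
  have hπ : Function.Surjective π := by
    rintro ⟨y, hy⟩
    obtain ⟨c, hc⟩ := (Submodule.mem_span_range_iff_exists_fun R).1 hy
    exact ⟨c, Subtype.ext hc⟩
  choose g hg using hπ
  have hker : LinearMap.ker π ≤ maximalIdeal R • (⊤ : Submodule R (Fin k → R)) := by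
    intro c hc
    have hc0 : ∑ i, c i • x i = 0 := congrArg Subtype.val (LinearMap.mem_ker.1 hc)
    rw [pi_eq_sum_univ' c]
    exact Submodule.sum_mem _ fun i _ => Submodule.smul_mem_smul
      ((mem_maximalIdeal _).2 (hx c hc0 i)) trivial
  have hspan : (⊤ : Submodule R (Fin k → R)) ≤ Submodule.span R (s.image g : Set (Fin k → R)) := by
    refine Submodule.le_of_le_smul_of_le_jacobson_bot (I := maximalIdeal R) Module.Finite.fg_top
      (maximalIdeal_le_jacobson _) ?_
    refine le_trans ?_ (sup_le_sup_left hker _)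
    intro c _
    have hmap : (Submodule.span R (s.image g : Set (Fin k → R))).map π = ⊤ := by
      rw [Submodule.map_span, ← htop, Finset.coe_image, Set.image_image]
      simp [hg]
    obtain ⟨d, hd, hdc⟩ : π c ∈ (Submodule.span R (s.image g : Set (Fin k → R))).map π := by
      rw [hmap]; trivial
    refine Submodule.mem_sup.2 ⟨d, hd, c - d, ?_, by abel⟩
    rw [LinearMap.mem_ker, map_sub, hdc, sub_self]
  have h1 := finrank_span_finset_le_card (R := R) (s.image g)
  rw [Set.finrank, top_le_iff.1 hspan, finrank_top, Module.finrank_fin_fun] at h1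
  exact h1.trans (Finset.card_image_le.trans hs)

end AnnDivisible
section Uniserial

variable {M : Type u} [AddCommGroup M] [Module R M]

/-- In a chain ring with non-principal maximal ideal, the non-units are the multiples of the terms
of some sequence of non-units. -/
theorem IsNilCoherentChain.exists_seq_dvd [Nontrivial R] (hR : IsNilCoherentChain R)
    (hP : ∀ q : R, ¬ IsUnit q → ∃ p : R, ¬ IsUnit p ∧ ¬ q ∣ p) :
    ∃ b : ℕ → R, (∀ k, ¬ IsUnit (b k)) ∧ ∀ p, ¬ IsUnit p → ∃ k, ∀ l, k ≤ l → b l ∣ p := by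
  have hstep : ∀ q : R, ¬ IsUnit q → ∃ p : R, ¬ IsUnit p ∧ p ^ 2 ∣ q := by
    intro q hq
    obtain ⟨p, hp, hqp⟩ := hP q hq
    obtain ⟨d, rfl⟩ := (hR.dvd_total q p).resolve_left hqp
    have hd : ¬ IsUnit d := fun hd => hqp (hd.mul_right_dvd.2 dvd_rfl)
    rcases hR.dvd_total p d with h | h
    · exact ⟨p, hp, by rw [pow_two]; exact mul_dvd_mul_left p h⟩
    · exact ⟨d, hd, by rw [pow_two]; exact mul_dvd_mul_right h d⟩
  choose! f hf hfd using hstep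
  obtain ⟨p₀, hp₀, hp₀'⟩ := hP 0 not_isUnit_zero
  have hnu : ∀ k, ¬ IsUnit (f^[k] p₀) := by
    intro k
    induction k with
    | zero => exact hp₀
    | succ k ih => rw [Function.iterate_succ_apply']; exact hf _ ih
  have hpow : ∀ k, (f^[k] p₀) ^ 2 ^ k ∣ p₀ := by
    intro k
    induction k with
    | zero => simp
    | succ k ih =>
      rw [Function.iterate_succ_apply', pow_succ', pow_mul]
      exact (pow_dvd_pow_of_dvd (hfd _ (hnu k)) _).trans ih
  refine ⟨fun k => f^[k] p₀, hnu, fun p hp => ?_⟩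
  obtain ⟨N, hN⟩ := hR.nilpotent p hp
  refine ⟨N, fun l hl => (hR.dvd_total _ _).resolve_right fun h => hp₀' ?_⟩
  have h0 : p ^ 2 ^ l = 0 := pow_eq_zero_of_le (hl.trans l.lt_two_pow_self.le) hN
  have := (pow_dvd_pow_of_dvd h (2 ^ l)).trans (hpow l)
  rwa [h0] at this

theorem IsAnnDivisible.exists_eq_smul_of_smul_eq (hR : IsNilCoherentChain R)
    (hM : IsAnnDivisible (⊤ : Submodule R M)) {a s : R} {y z : M} (h : a • y = (a * s) • z)
    (h0 : a • y ≠ 0) : ∃ v, y = s • v := by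
  obtain ⟨s', hs⟩ := hR.exists_isAnnPair s
  obtain ⟨v, -, hv⟩ := hM s' s hs.symm y trivial (by
    rcases hR.dvd_total a s' with ⟨d, rfl⟩ | ⟨d, rfl⟩
    · rw [mul_comm, mul_smul, h, smul_smul]
      have : d * (a * s) = 0 := by linear_combination hs.mul_eq_zero
      rw [this, zero_smul]
    · refine absurd ?_ h0
      have : s' * d * s = 0 := by linear_combination d * hs.mul_eq_zero
      rw [h, this, zero_smul])
  exact ⟨v, hv⟩

/-- Every nonzero element lies in a uniserial submodule which is closed under the available
divisions. -/
theorem IsAnnDivisible.exists_uniserial [Nontrivial R] (hR : IsNilCoherentChain R)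
    (hP : ∀ q : R, ¬ IsUnit q → ∃ p : R, ¬ IsUnit p ∧ ¬ q ∣ p)
    (hM : IsAnnDivisible (⊤ : Submodule R M)) {x : M} (hx : x ≠ 0) :
    ∃ W : Submodule R M, IsAnnDivisible W ∧ x ∈ W ∧
      ∀ v ∈ W, ∀ w ∈ W, ∃ c : R, v = c • w ∨ w = c • v := by
  have hcyc : ∀ y : M, ∀ a b : R, ∃ c : R, a • y = c • b • y ∨ b • y = c • a • y := by
    intro y a b
    rcases hR.dvd_total a b with ⟨c, rfl⟩ | ⟨c, rfl⟩
    · exact ⟨c, .inr (by rw [smul_smul, mul_comm])⟩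
    · exact ⟨c, .inl (by rw [smul_smul, mul_comm])⟩
  by_cases hmax : ∃ y : M, (∃ r : R, x = r • y) ∧ ∀ (s : R) (z : M), y = s • z → IsUnit s
  · obtain ⟨y, ⟨r, rfl⟩, hy⟩ := hmax
    refine ⟨Submodule.span R {y}, ?_, Submodule.mem_span_singleton.2 ⟨r, rfl⟩, ?_⟩
    · intro t s hts w hw htw
      obtain ⟨v, -, hv⟩ := hM t s hts w trivial htw
      by_cases hw0 : w = 0
      · exact ⟨0, zero_mem _, by rw [hw0, smul_zero]⟩
      obtain ⟨a, rfl⟩ := Submodule.mem_span_singleton.1 hw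
      rcases hR.dvd_total s a with ⟨d, rfl⟩ | ⟨d, rfl⟩
      · exact ⟨d • y, Submodule.smul_mem _ _ (Submodule.mem_span_singleton_self y),
          by rw [smul_smul]⟩
      · obtain ⟨z, hz⟩ := hM.exists_eq_smul_of_smul_eq hR hv hw0
        obtain ⟨e, rfl⟩ := hy d z hz
        refine ⟨(↑e⁻¹ : R) • y, Submodule.smul_mem _ _ (Submodule.mem_span_singleton_self y), ?_⟩
        rw [smul_smul, mul_assoc, Units.mul_inv, mul_one]
    · intro v hv w hw
      obtain ⟨a, rfl⟩ := Submodule.mem_span_singleton.1 hv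
      obtain ⟨b, rfl⟩ := Submodule.mem_span_singleton.1 hw
      exact hcyc y a b
  · have hdiv : ∀ y : M, (∃ r : R, x = r • y) → ∃ (s : R) (z : M), y = s • z ∧ ¬ IsUnit s := by
      push Not at hmax
      exact hmax
    obtain ⟨b, hb, hbP⟩ := hR.exists_seq_dvd hP
    have hstep : ∀ (k : ℕ) (y : M), y ≠ 0 → ∃ z : M, (∃ r : R, y = r • z) ∧ ∀ v, z ≠ b k • v := by
      classical
      intro k y hy
      by_contra! h
      have hall : ∀ m : ℕ, ∃ z, y = b k ^ m • z := by
        intro m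
        induction m with
        | zero => exact ⟨y, by simp⟩
        | succ m ih =>
          obtain ⟨z, hz⟩ := ih
          obtain ⟨v, hv⟩ := h z ⟨_, hz⟩
          exact ⟨v, by rw [pow_succ, mul_smul, ← hv, hz]⟩
      obtain ⟨N, hN⟩ := hR.nilpotent _ (hb k)
      obtain ⟨z, hz⟩ := hall N
      exact hy (by rw [hz, hN, zero_smul])
    choose! g hg hgb using hstep
    let y : ℕ → M := fun k => Nat.rec x (fun k z => g k z) k
    have hy0 : ∀ k, y k ≠ 0 := by
      intro k
      induction k with
      | zero => exact hx
      | succ k ih =>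
        intro h0
        obtain ⟨r, hr⟩ := hg k (y k) ih
        exact ih (by rw [hr]; change r • y (k + 1) = 0; rw [h0, smul_zero])
    have hys : ∀ k, ∃ r : R, y k = r • y (k + 1) := fun k => hg k (y k) (hy0 k)
    have hyb : ∀ k v, y (k + 1) ≠ b k • v := fun k => hgb k (y k) (hy0 k)
    have hyle : ∀ k l, k ≤ l → ∃ r : R, y k = r • y l := by
      intro k l hkl
      induction l, hkl using Nat.le_induction with
      | base => exact ⟨1, (one_smul R _).symm⟩
      | succ l _ ih =>
        obtain ⟨r, hr⟩ := ih
        obtain ⟨r', hr'⟩ := hys l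
        exact ⟨r * r', by rw [hr, hr', smul_smul]⟩
    have hmono : Monotone fun k => Submodule.span R {y k} := by
      refine monotone_nat_of_le_succ fun k => ?_
      rw [Submodule.span_singleton_le_iff_mem]
      obtain ⟨r, hr⟩ := hys k
      exact Submodule.mem_span_singleton.2 ⟨r, hr.symm⟩
    have hmem : ∀ w, w ∈ (⨆ k, Submodule.span R {y k}) ↔ ∃ k, ∃ a : R, a • y k = w := by
      intro w
      simp only [Submodule.mem_iSup_of_directed _ hmono.directed_le, Submodule.mem_span_singleton]
    refine ⟨⨆ k, Submodule.span R {y k}, ?_, (hmem x).2 ⟨0, 1, one_smul R _⟩, ?_⟩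
    · intro t s hts w hw htw
      obtain ⟨v, -, hv⟩ := hM t s hts w trivial htw
      by_cases hw0 : w = 0
      · exact ⟨0, zero_mem _, by rw [hw0, smul_zero]⟩
      obtain ⟨k, a, rfl⟩ := (hmem w).1 hw
      rcases hR.dvd_total s a with ⟨d, rfl⟩ | ⟨d, rfl⟩
      · exact ⟨d • y k, (hmem _).2 ⟨k, d, rfl⟩, by rw [smul_smul]⟩
      · obtain ⟨z, hz⟩ := hM.exists_eq_smul_of_smul_eq hR hv hw0
        obtain ⟨r, hr⟩ := hyle 0 k k.zero_le
        obtain ⟨d', z', hz', hd'⟩ := hdiv z ⟨r * d, by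
          rw [mul_smul, ← hz]
          exact hr⟩
        obtain ⟨l₀, hl₀⟩ := hbP d' hd'
        obtain ⟨l, hl₀l, hkl⟩ : ∃ l, l₀ ≤ l ∧ k ≤ l :=
            ⟨max l₀ k, le_max_left _ _, le_max_right _ _⟩
        obtain ⟨f, hf⟩ := hl₀ l hl₀l
        obtain ⟨e, he⟩ := hyle k (l + 1) (by omega)
        rcases hR.dvd_total d e with ⟨h, rfl⟩ | ⟨h, rfl⟩
        · exact ⟨h • y (l + 1), (hmem _).2 ⟨l + 1, h, rfl⟩, by
            rw [he]; simp only [smul_smul]; ring_nf⟩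
        · obtain ⟨v', hv'⟩ := hM.exists_eq_smul_of_smul_eq hR (a := e) (s := h * d')
            (y := y (l + 1)) (z := z') (by
              rw [← he, hz, hz', smul_smul]; ring_nf) (by rw [← he]; exact hy0 k)
          refine absurd ?_ (hyb l ((h * f) • v'))
          rw [hv', hf, smul_smul]
          ring_nf
    · intro v hv w hw
      obtain ⟨k, a, rfl⟩ := (hmem v).1 hv
      obtain ⟨l, b, rfl⟩ := (hmem w).1 hw
      obtain ⟨r, hr⟩ := hyle k (max k l) (le_max_left _ _)
      obtain ⟨r', hr'⟩ := hyle l (max k l) (le_max_right _ _)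
      rw [hr, hr', smul_smul, smul_smul]
      exact hcyc _ _ _

end Uniserial
theorem IsNilCoherentChain.exists_uniserial_isSeqInjective [IsLocalRing R]
    (hR : IsNilCoherentChain R)
    (hP : ∀ q : R, ¬ IsUnit q → ∃ p : R, ¬ IsUnit p ∧ ¬ q ∣ p) (n : ℕ)
    (hgen : ∀ (M : Type u) [AddCommGroup M] [Module R M],
      Module.Finite R M → IsUniformMod R M →
      ∃ s : Finset M, s.card ≤ n ∧ Submodule.span R (s : Set M) = ⊤) :
    ∃ (V : Type u) (_ : AddCommGroup V) (_ : Module R V), Nontrivial V ∧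
      IsAnnDivisible (⊤ : Submodule R V) ∧ IsSeqInjective R V ∧
      ∀ v w : V, ∃ c : R, v = c • w ∨ w = c • v := by
  classical
  obtain ⟨E, _, _, hinj, hunif, hnt⟩ := exists_injective_uniform hR.dvd_total
  have hE := hinj.isAnnDivisible
  have hbound : ∀ (k : ℕ) (U : Submodule R E), HasIndependentFamily k U → k ≤ n := by
    intro k U hk
    obtain ⟨x, -, hx⟩ := hk 0 not_isUnit_zero
    refine le_of_linearIndependent_mod_nonunits x
      (fun c hc => hx c ⟨0, zero_mem _, by rw [hc, smul_zero]⟩) (hgen _ ?_ ?_)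
    · exact Module.Finite.span_of_finite R (Set.finite_range x)
    · intro N₁ N₂ h₁ h₂ h
      have hsub := (Submodule.span R (Set.range x)).injective_subtype
      have hne : ∀ {N : Submodule R (Submodule.span R (Set.range x))}, N ≠ ⊥ →
          N.map (Submodule.span R (Set.range x)).subtype ≠ ⊥ := fun hN h =>
        hN (Submodule.map_injective_of_injective hsub (by rw [h, Submodule.map_bot]))
      refine hunif _ _ (hne h₁) (hne h₂) ?_
      rw [← Submodule.map_inf _ hsub, h, Submodule.map_bot]
  let S : ℕ → Prop := fun k => ∃ U : Submodule R E, IsAnnDivisible U ∧ U < ⊤ ∧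
    HasIndependentFamily k U
  have hS0 : S 0 := ⟨⊥, isAnnDivisible_bot, bot_lt_top, hasIndependentFamily_zero ⊥⟩
  obtain ⟨U, hU, hUlt, hUk⟩ : S (Nat.findGreatest S n) := Nat.findGreatest_spec n.zero_le hS0
  have hV := hE.quotient hU
  have hsimple : ∀ W : Submodule R (E ⧸ U), IsAnnDivisible W → W ≠ ⊥ → W = ⊤ := by
    intro W hW hW0
    by_contra hWt
    have hlt : U < W.comap U.mkQ := by
      refine lt_of_le_of_ne (fun u hu => ?_) fun h => hW0 ?_
      · rw [Submodule.mem_comap, Submodule.mkQ_apply, (Submodule.Quotient.mk_eq_zero U).2 hu]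
        exact W.zero_mem
      rw [← Submodule.map_comap_eq_of_surjective U.mkQ_surjective W, ← h, Submodule.mkQ_map_self]
    have hlt' : W.comap U.mkQ < ⊤ := by
      refine lt_top_iff_ne_top.2 fun h => hWt ?_
      rw [← Submodule.map_comap_eq_of_surjective U.mkQ_surjective W, h, Submodule.map_top,
        Submodule.range_mkQ]
    have hD := hU.comap_mkQ hW
    have hk := hUk.succ hR hP hU hD hlt
    exact absurd (Nat.le_findGreatest (P := S) (hbound _ _ hk) ⟨_, hD, hlt', hk⟩) (by omega)
  have hnt : Nontrivial (E ⧸ U) := Submodule.Quotient.nontrivial_iff.2 hUlt.ne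
  obtain ⟨x, hx⟩ := exists_ne (0 : E ⧸ U)
  obtain ⟨W, hW, hxW, huni⟩ := hV.exists_uniserial hR hP hx
  have hWt : W = ⊤ := hsimple W hW fun h => hx (by simpa [h] using hxW)
  exact ⟨E ⧸ U, inferInstance, inferInstance, hnt, hV, hinj.isSeqInjective.quotient hR hU,
    fun v w => huni v (hWt ▸ trivial) w (hWt ▸ trivial)⟩

section PseudoConvergent

variable {V : Type u} [AddCommGroup V] [Module R V]

theorem IsSeqInjective.exists_forall_dvd_sub [IsLocalRing R] (hR : IsNilCoherentChain R)
    (hV : IsSeqInjective R V) (huni : ∀ v w : V, ∃ c : R, v = c • w ∨ w = c • v)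
    (r α : ℕ → R) (hr : ∀ j, ∃ p, ¬ IsUnit p ∧ r (j + 1) = r j * p) (v : V)
    (hv : ∀ j, r j • v ≠ 0) (hα : ∀ j, r j ∣ α (j + 1) - α j) :
    ∃ b, ∀ j, r j ∣ b - α j := by
  have ht : ∀ j, ∃ t : R, (t * r j) • v ≠ 0 ∧ (t * r (j + 1)) • v = 0 := by
    intro j
    obtain ⟨p, hp, hrp⟩ := hr j
    obtain ⟨q, hq, hq'⟩ := exists_notMem_mul_mem_of_isNilpotent (⊥ : Submodule R V) (x := r j • v)
      (hv j) (hR.nilpotent p hp)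
    rw [Submodule.mem_bot, smul_smul] at hq hq'
    exact ⟨q, hq, by rw [hrp, ← hq']; ring_nf⟩
  choose t ht ht' using ht
  have hzero : ∀ {a b : R}, a ∣ b → a • v = 0 → b • v = 0 := by
    rintro a _ ⟨c, rfl⟩ h
    rw [mul_comm, mul_smul, h, smul_zero]
  obtain ⟨w, hw⟩ := hV t (fun j => α (j + 1) • v)
    (fun j => (hR.dvd_total _ _).resolve_right fun h =>
      ht (j + 1) (hzero (mul_dvd_mul_right h _) (ht' j)))
    (fun j => by
      rw [← sub_smul, smul_smul]
      exact hzero (mul_dvd_mul_left (t j) (hα (j + 1))) (ht' j))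
  obtain ⟨b, hb⟩ : ∃ b : R, ∀ j, (t j * (b - α (j + 1))) • v = 0 := by
    obtain ⟨c, rfl | hc⟩ := huni w v
    · exact ⟨c, fun j => by rw [mul_smul, sub_smul]; exact hw j⟩
    · by_cases hcu : IsUnit c
      · obtain ⟨c, rfl⟩ := hcu
        refine ⟨(↑c⁻¹ : R), fun j => ?_⟩
        rw [mul_smul, sub_smul, ← hw j]
        congr 2
        rw [hc, smul_smul, Units.inv_mul, one_smul]
      · refine ⟨0, fun j => ?_⟩
        have h1 : (1 - α (j + 1) * c) • t j • w = 0 := by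
          rw [smul_smul, mul_comm, mul_smul, sub_smul, one_smul, mul_smul, ← hc]
          exact hw j
        have hu : IsUnit (1 - α (j + 1) * c) := by
          rcases isUnit_or_isUnit_one_sub_self (α (j + 1) * c) with h | h
          · exact absurd (isUnit_of_mul_isUnit_right h) hcu
          · exact h
        have h2 : t j • w = 0 := hu.smul_eq_zero.1 h1
        have : t j * (0 - α (j + 1)) = -(α (j + 1)) * t j := by ring
        rw [this, hc, smul_smul, mul_comm _ c, ← mul_assoc, mul_smul, h2, smul_zero]
  refine ⟨b, fun j => ?_⟩
  have h1 : r j ∣ b - α (j + 1) := (hR.dvd_total _ _).resolve_right fun h =>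
    ht j (hzero (mul_dvd_mul_left (t j) h) (hb j))
  have := h1.add (hα j)
  rwa [sub_add_sub_cancel] at this

theorem IsNilCoherentChain.exists_forall_dvd_sub [IsLocalRing R] (hR : IsNilCoherentChain R)
    [Nontrivial V] (hD : IsAnnDivisible (⊤ : Submodule R V)) (hV : IsSeqInjective R V)
    (huni : ∀ v w : V, ∃ c : R, v = c • w ∨ w = c • v)
    (r α : ℕ → R) (hr : ∀ j, ∃ p, ¬ IsUnit p ∧ r (j + 1) = r j * p) (hr0 : ¬ IsUnit (r 0))
    (hne : ∀ j, r j ≠ 0) (hα : ∀ j, r j ∣ α (j + 1) - α j) :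
    ∃ b, ∀ j, r j ∣ b - α j := by
  obtain ⟨s, hs⟩ := hR.exists_isAnnPair (r 0)
  obtain ⟨v, -, hv⟩ := isAnnDivisible_bot.exists_forall_dvd hR hD bot_lt_top hr0 hs
  have hdvd : ∀ j, r 0 ∣ r j ∧ r 0 ∣ α j - α 0 := by
    intro j
    induction j with
    | zero => simp
    | succ j ih =>
      obtain ⟨p, -, hp⟩ := hr j
      refine ⟨hp ▸ ih.1.mul_right p, ?_⟩
      have := (ih.1.trans (hα j)).add ih.2
      rwa [sub_add_sub_cancel] at this
  choose r' hr' using fun j => (hdvd j).1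
  choose α' hα' using fun j => (hdvd j).2
  have hcancel : ∀ j x, r j ∣ r 0 * x → r' j ∣ x := by
    rintro j x ⟨h, hh⟩
    have h1 : s ∣ x - r' j * h := (hs.1 _).1 (by linear_combination hh + h * hr' j)
    have h2 : r' j ∣ s := (hR.dvd_total _ _).resolve_right fun h =>
      hne j (by rw [hr' j]; exact (hs.1 _).2 h)
    have := (h2.trans h1).add (Dvd.intro h rfl)
    rwa [sub_add_cancel] at this
  obtain ⟨b, hb⟩ := hV.exists_forall_dvd_sub hR huni r' α' (fun j => by
      obtain ⟨p, hp, hrp⟩ := hr j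
      obtain ⟨d, hd⟩ := hcancel j (r' (j + 1)) (by rw [← hr', hrp]; exact Dvd.intro p rfl)
      refine ⟨d, fun hdu => ?_, hd⟩
      obtain ⟨d, rfl⟩ := hdu
      have h1 : r (j + 1) = r j * d := by rw [hr' (j + 1), hd, hr' j]; ring
      have hu : IsUnit ((d : R) - p) := by
        rcases isUnit_or_isUnit_one_sub_self (p * (↑d⁻¹ : R)) with h | h
        · exact absurd (isUnit_of_mul_isUnit_left h) hp
        · have := h.mul d.isUnit
          rwa [sub_mul, one_mul, mul_assoc, Units.inv_mul, mul_one] at this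
      exact hne j (hu.mul_left_eq_zero.1 (by linear_combination hrp - h1)))
    v (fun j h0 => hne j (by
      rw [hr' j]
      exact (hs.1 _).2 (hv (r' j) (by simpa using h0))))
    (fun j => hcancel j _ (by
      have : r 0 * (α' (j + 1) - α' j) = α (j + 1) - α j := by
        linear_combination hα' j - hα' (j + 1)
      rw [this]
      exact hα j))
  refine ⟨α 0 + r 0 * b, fun j => ?_⟩
  obtain ⟨d, hd⟩ := hb j
  exact ⟨d, by linear_combination r 0 * hd - hα' j - d * hr' j⟩

end PseudoConvergent

theorem IsNilCoherentChain.exists_cofinal_seq [Nontrivial R] (hR : IsNilCoherentChain R)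
    (hP : ∀ q : R, ¬ IsUnit q → ∃ p : R, ¬ IsUnit p ∧ ¬ q ∣ p) {A : Ideal R}
    (h1 : (1 : R) ∉ A) (hA : ∀ r ∉ A, ∃ p, ¬ IsUnit p ∧ r * p ∉ A) :
    ∃ r : ℕ → R, (∀ j, ∃ p, ¬ IsUnit p ∧ r (j + 1) = r j * p) ∧ ¬ IsUnit (r 0) ∧
      (∀ j, r j ∉ A) ∧ ∀ y ∉ A, ∃ j, y ∣ r j := by
  obtain ⟨b, hb, hbP⟩ := hR.exists_seq_dvd hP
  have hf : ∀ k, ∃ f : R, f ∉ A ∧ f * b k ∈ A := fun k => by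
    simpa using exists_notMem_mul_mem_of_isNilpotent A h1 (hR.nilpotent _ (hb k))
  choose f hf hfb using hf
  have hstep : ∀ (k : ℕ) (r : R), r ∉ A → ∃ p, ¬ IsUnit p ∧ r * p ∉ A ∧ f k ∣ r * p := by
    intro k r hr
    rcases hR.dvd_total r (f k) with ⟨c, hc⟩ | h
    · obtain ⟨p, hp, hp'⟩ := hA _ (hf k)
      exact ⟨c * p, fun h => hp (isUnit_of_mul_isUnit_right h), by rwa [← mul_assoc, ← hc],
        by rw [← mul_assoc, ← hc]; exact Dvd.intro p rfl⟩
    · obtain ⟨p, hp, hp'⟩ := hA r hr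
      exact ⟨p, hp, hp', h.mul_right p⟩
  choose! g hg hgA hgf using hstep
  obtain ⟨p, hp, hpA⟩ := hA 1 h1
  let r : ℕ → R := fun j => Nat.rec p (fun k r => r * g k r) j
  have hrA : ∀ j, r j ∉ A := by
    intro j
    induction j with
    | zero => rwa [one_mul] at hpA
    | succ j ih => exact hgA j _ ih
  refine ⟨r, fun j => ⟨_, hg j _ (hrA j), rfl⟩, hp, hrA, fun y hy => ?_⟩
  obtain ⟨d, hd, hyd⟩ := hA y hy
  obtain ⟨k, hk⟩ := hbP d hd
  have hyf : y ∣ f k := (hR.dvd_total _ _).resolve_right fun h =>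
    hyd (A.mem_of_dvd (mul_dvd_mul h (hk k le_rfl)) (hfb k))
  exact ⟨k + 1, hyf.trans (hgf k _ (hrA k))⟩

theorem IsNilCoherentChain.isMaximalRing [IsLocalRing R] (hR : IsNilCoherentChain R) (n : ℕ)
    (hgen : ∀ (M : Type u) [AddCommGroup M] [Module R M],
      Module.Finite R M → IsUniformMod R M →
      ∃ s : Finset M, s.card ≤ n ∧ Submodule.span R (s : Set M) = ⊤) :
    IsMaximalRing R := by
  classical
  intro ι a A hfip
  have hpair : ∀ {i j} {J : Ideal R}, A i ≤ J → A j ≤ J → a i - a j ∈ J := by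
    intro i j J hi hj
    obtain ⟨x, hx⟩ := hfip {i, j}
    have := J.sub_mem (hj (hx j (by simp))) (hi (hx i (by simp)))
    rwa [sub_sub_sub_cancel_left] at this
  by_cases hmin : ∃ i, ∀ j, A i ≤ A j
  · obtain ⟨i, hi⟩ := hmin
    exact ⟨a i, fun j => hpair (hi j) le_rfl⟩
  push Not at hmin
  rcases isEmpty_or_nonempty ι with _ | ⟨⟨i₀⟩⟩
  · exact ⟨0, fun i => isEmptyElim i⟩
  have hle : ∀ {i} {r : R}, r ∉ A i → ∀ x ∈ A i, r ∣ x := fun hr x hx =>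
    (hR.dvd_total _ _).resolve_right fun h => hr (Ideal.mem_of_dvd _ h hx)
  have hnext : ∀ r ∉ ⨅ i, A i, ∃ p, ¬ IsUnit p ∧ r * p ∉ ⨅ i, A i := by
    intro r hr
    obtain ⟨i, hi⟩ : ∃ i, r ∉ A i := by simpa using hr
    obtain ⟨j, hj⟩ := hmin i
    obtain ⟨x, hx, hxj⟩ := SetLike.not_le_iff_exists.1 hj
    obtain ⟨p, rfl⟩ := hle hi x hx
    exact ⟨p, fun hp => hi ((A i).mem_of_dvd (hp.mul_right_dvd.2 dvd_rfl) hx),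
      fun h => hxj (Ideal.mem_iInf.1 h j)⟩
  have h1 : (1 : R) ∉ ⨅ i, A i := by
    intro h
    obtain ⟨j, hj⟩ := hmin i₀
    exact hj (by simp [(Ideal.eq_top_iff_one (A j)).2 (Ideal.mem_iInf.1 h j)])
  by_cases hP : ∀ q : R, ¬ IsUnit q → ∃ p : R, ¬ IsUnit p ∧ ¬ q ∣ p
  · obtain ⟨V, _, _, _, hD, hV, huni⟩ := hR.exists_uniserial_isSeqInjective hP n hgen
    obtain ⟨r, hr, hr0, hrA, hcof⟩ := hR.exists_cofinal_seq hP h1 hnext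
    have hri : ∀ j, ∃ i, r j ∉ A i := fun j => by simpa using hrA j
    choose i hi using hri
    have hAr : ∀ j x, x ∈ A (i j) → r j ∣ x := fun j => hle (hi j)
    obtain ⟨b, hb⟩ := hR.exists_forall_dvd_sub hD hV huni r (fun j => a (i j)) hr hr0
      (fun j h => hrA j (h ▸ zero_mem _)) (fun j => by
        obtain ⟨p, -, hp⟩ := hr j
        refine Ideal.mem_span_singleton.1 (hpair (fun x hx => ?_) fun x hx => ?_)
        · exact Ideal.mem_span_singleton.2 ((Dvd.intro p hp.symm).trans (hAr _ x hx))
        · exact Ideal.mem_span_singleton.2 (hAr _ x hx))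
    refine ⟨b, fun k => ?_⟩
    obtain ⟨l, hl⟩ := hmin k
    obtain ⟨y, hy, hyl⟩ := SetLike.not_le_iff_exists.1 hl
    obtain ⟨j, hj⟩ := hcof y fun h => hyl (Ideal.mem_iInf.1 h l)
    have hrk : r j ∈ A k := (A k).mem_of_dvd hj hy
    have := (A k).add_mem ((A k).mem_of_dvd (hb j) hrk)
      (hpair (fun x hx => (A k).mem_of_dvd (hAr j x hx) hrk) (le_refl (A k)))
    rwa [sub_add_sub_cancel] at this
  · push Not at hP
    obtain ⟨q, hq, hqP⟩ := hP
    obtain ⟨N, hN⟩ := hR.nilpotent q hq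
    have hpow : ∀ m : ℕ, q ^ m ∉ ⨅ i, A i := by
      intro m
      induction m with
      | zero => simpa only [pow_zero] using h1
      | succ m ih =>
        obtain ⟨p, hp, hp'⟩ := hnext _ ih
        exact fun h => hp' (Ideal.mem_of_dvd _ (mul_dvd_mul_left _ (hqP p hp)) (pow_succ q m ▸ h))
    exact absurd (hN ▸ zero_mem _) (hpow N)

theorem IsMaximalRing.of_surjective {S : Type u} [CommRing S] (hR : IsMaximalRing R)
    (f : R →+* S) (hf : Function.Surjective f) : IsMaximalRing S := by
  intro ι a A hfip
  choose a' ha' using fun i => hf (a i)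
  obtain ⟨x, hx⟩ := hR ι a' (fun i => (A i).comap f) fun s => by
    obtain ⟨y, hy⟩ := hfip s
    obtain ⟨x, rfl⟩ := hf y
    exact ⟨x, fun i hi => by simpa [ha'] using hy i hi⟩
  exact ⟨f x, fun i => by simpa [ha'] using hx i⟩

theorem IsArchimedeanLocal.isNilCoherentChain_quotient [IsLocalRing R] (harch : IsArchimedeanLocal R)
    (hchain : IsChainRing R) {a : R} (ha : a ≠ 0) :
    IsNilCoherentChain (R ⧸ Ideal.span {a}) := by
  have htot : ∀ x y : R, x ∣ y ∨ y ∣ x := fun x y => by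
    simpa only [Ideal.span_singleton_le_span_singleton] using
      hchain (Ideal.span {y}) (Ideal.span {x})
  have hsurj := Ideal.Quotient.mk_surjective (I := Ideal.span {a})
  refine ⟨hsurj.forall₂.2 fun x y => ?_, hsurj.forall.2 fun p hp => ?_,
    hsurj.forall.2 fun t => ?_⟩
  · exact (htot x y).imp (map_dvd _) (map_dvd _)
  · have hpm : p ∈ maximalIdeal R := fun h => hp (h.map _)
    obtain ⟨N, hN⟩ : p ∈ (Ideal.span {a}).radical := by
      rw [Ideal.radical_eq_sInf]
      refine Submodule.mem_sInf.2 fun Q hQ => ?_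
      rw [harch Q hQ.2 fun h => ha ?_]
      · exact hpm
      · simpa [h] using hQ.1
    exact ⟨N, by rwa [← map_pow, Ideal.Quotient.eq_zero_iff_mem]⟩
  · by_cases hat : a ∣ t
    · refine ⟨1, fun x => iff_of_true ?_ (one_dvd x)⟩
      rw [(Ideal.Quotient.eq_zero_iff_dvd a t).2 hat, zero_mul]
    obtain ⟨s, rfl⟩ := (htot a t).resolve_left hat
    refine ⟨Ideal.Quotient.mk _ s, hsurj.forall.2 fun x => ⟨fun hx => map_dvd _ ?_, fun hx => ?_⟩⟩
    · rw [← map_mul, Ideal.Quotient.eq_zero_iff_dvd] at hx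
      obtain ⟨c, hc⟩ := hx
      have h0 : t * (x - s * c) = 0 := by linear_combination hc
      have := ((htot s (x - s * c)).resolve_right fun ⟨d, hd⟩ =>
        ha (by rw [hd]; linear_combination d * h0)).add (Dvd.intro c rfl)
      rwa [sub_add_cancel] at this
    · refine zero_dvd_iff.1 ((((Ideal.Quotient.eq_zero_iff_dvd _ _).2 dvd_rfl).symm.trans
        (map_mul _ t s)).dvd.trans (mul_dvd_mul_left _ hx))

theorem exists_span_eq_top_quotient (I : Ideal R) (n : ℕ)
    (hgen : ∀ (M : Type u) [AddCommGroup M] [Module R M],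
      Module.Finite R M → IsUniformMod R M →
      ∃ s : Finset M, s.card ≤ n ∧ Submodule.span R (s : Set M) = ⊤)
    (M : Type u) [AddCommGroup M] [Module (R ⧸ I) M] (hM : Module.Finite (R ⧸ I) M)
    (huni : IsUniformMod (R ⧸ I) M) :
    ∃ s : Finset M, s.card ≤ n ∧ Submodule.span (R ⧸ I) (s : Set M) = ⊤ := by
  let _ : Module R M := Module.compHom M (Ideal.Quotient.mk I)
  have : IsScalarTower R (R ⧸ I) M := ⟨fun r q m => by
    rw [Algebra.smul_def]
    exact mul_smul (Ideal.Quotient.mk I r) q m⟩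
  have hsurj : Function.Surjective (algebraMap R (R ⧸ I)) := Ideal.Quotient.mk_surjective
  obtain ⟨s, hs, hspan⟩ := hgen M (Module.Finite.trans (R ⧸ I) M) fun N₁ N₂ h₁ h₂ h => by
    let e := Submodule.orderIsoOfAlgebraMapSurjective (M := M) hsurj
    refine huni (e.symm N₁) (e.symm N₂) ?_ ?_ ?_
    · simpa using h₁
    · simpa using h₂
    · rw [← map_inf, h, map_bot]
  refine ⟨s, hs, Submodule.restrictScalars_injective R (R ⧸ I) M ?_⟩
  rw [Submodule.restrictScalars_span R (R ⧸ I) hsurj, hspan, Submodule.restrictScalars_top]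

end ChainRing

theorem stmt10 (R : Type u) [CommRing R] [IsLocalRing R]
    (hchain : IsChainRing R) (harch : IsArchimedeanLocal R)
    (n : ℕ) (hn : 0 < n)
    (hgen : ∀ (M : Type u) [AddCommGroup M] [Module R M],
      Module.Finite R M → IsUniformMod R M →
      ∃ s : Finset M, s.card ≤ n ∧ Submodule.span R (s : Set M) = ⊤) :
    IsAlmostMaximalRing R := by
  intro A hA
  obtain ⟨a, haA, ha⟩ := Submodule.exists_mem_ne_zero_of_ne_bot hA
  rcases eq_or_ne A ⊤ with rfl | hAt
  · exact fun ι b B _ => ⟨0, fun i => by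
      rw [Subsingleton.elim (0 - b i) 0]
      exact zero_mem _⟩
  have hle : Ideal.span {a} ≤ A := (Ideal.span_singleton_le_iff_mem A).2 haA
  have : Nontrivial (R ⧸ Ideal.span {a}) :=
    Ideal.Quotient.nontrivial_iff.2 fun h => hAt (top_le_iff.1 (h ▸ hle))
  have := IsLocalRing.of_surjective' _ (Ideal.Quotient.mk_surjective (I := Ideal.span {a}))
  have hmax := (harch.isNilCoherentChain_quotient hchain ha).isMaximalRing n
    fun M _ _ => exists_span_eq_top_quotient (Ideal.span {a}) n hgen M
  exact hmax.of_surjective (Ideal.Quotient.factor hle) (Ideal.Quotient.factor_surjective hle)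
end

section
/- Every commutative local ring of bounded module type is an almost maximal valuation ring. -/
open IsLocalRing

universe u

/-- Over a local ring of bounded module type, a module presented with `K` inside the radical of a
free module has at most `n` generators indexed by `τ` on which every endomorphism is, modulo the
maximal ideal, triangular with constant diagonal. -/
lemma HasBoundedModuleType.card_le {R : Type u} [CommRing R] [IsLocalRing R] {n : ℕ}
    (hb : HasBoundedModuleType R n) {ι : Type} [Fintype ι] [DecidableEq ι] {m : ℕ}
    (K : Submodule R (ι → R)) (hK : ∀ x ∈ K, ∀ j, x j ∈ maximalIdeal R) (τ : Fin m → ι)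
    (hΦ : ∀ Φ : Matrix ι ι R, (∀ x ∈ K, Φ.mulVec x ∈ K) →
      (∀ j l, Φ (τ j) (τ j) - Φ (τ l) (τ l) ∈ maximalIdeal R) ∧
        ∀ j l, j < l → Φ (τ j) (τ l) ∈ maximalIdeal R) : m ≤ n := by
  classical
  rcases Nat.eq_zero_or_pos m with rfl | hm
  · exact Nat.zero_le n
  obtain ⟨κ, N, hind, htop, hgen⟩ := hb ((ι → R) ⧸ K) inferInstance
  let j₀ : Fin m := ⟨0, hm⟩
  have hcompl : ∀ i, IsCompl (N i) (⨆ j ≠ i, N j) := fun i =>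
    ⟨hind i, codisjoint_iff.2 (by rw [← htop, iSup_split_single N i])⟩
  let e : ∀ i : κ, ((ι → R) ⧸ K) →ₗ[R] ((ι → R) ⧸ K) := fun i =>
    Submodule.projection (N i) (⨆ j ≠ i, N j) (hcompl i)
  choose g hg using fun (i : κ) (l : ι) =>
    Submodule.mkQ_surjective K (e i (K.mkQ (Pi.single l 1)))
  let Φ : κ → Matrix ι ι R := fun i => Matrix.of fun j l => g i l j
  have hmul : ∀ i x, K.mkQ ((Φ i).mulVec x) = e i (K.mkQ x) := by
    intro i x
    have h1 : (Φ i).mulVec x = ∑ l, x l • g i l := by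
      ext j
      simp [Φ, Matrix.mulVec, dotProduct, mul_comm]
    have h2 : x = ∑ l, x l • (Pi.single l 1 : ι → R) := by
      ext j
      simp [Pi.single_apply]
    conv_rhs => rw [h2]
    rw [h1]
    simp only [map_sum, map_smul, hg]
  have hpres : ∀ i, ∀ x ∈ K, (Φ i).mulVec x ∈ K := by
    intro i x hx
    rw [← Submodule.Quotient.mk_eq_zero, ← Submodule.mkQ_apply, hmul, Submodule.mkQ_apply,
      (Submodule.Quotient.mk_eq_zero K).2 hx, map_zero]
  obtain ⟨f, hf, hfsum⟩ := (Submodule.mem_iSup_iff_exists_finsupp N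
    (K.mkQ (Pi.single (τ j₀) 1))).1 (by rw [htop]; trivial)
  have hef : ∀ i, e i (K.mkQ (Pi.single (τ j₀) 1)) = f i := by
    intro i
    have h0 : ∀ l ≠ i, e i (f l) = 0 := fun l hl => by
      rw [← LinearMap.mem_ker, Submodule.ker_projection]
      exact (le_iSup₂_of_le l hl le_rfl : N l ≤ _) (hf l)
    rw [← hfsum, Finsupp.sum, map_sum, Finset.sum_eq_single i (fun l _ hl => h0 l hl)]
    · exact Submodule.projection_apply_of_mem_left _ (hf i)
    · intro hi
      rw [Finsupp.notMem_support_iff.1 hi, map_zero]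
  have hsumK : ∑ i ∈ f.support, g i (τ j₀) - Pi.single (τ j₀) 1 ∈ K := by
    rw [← Submodule.Quotient.mk_eq_zero, ← Submodule.mkQ_apply, map_sub, map_sum]
    simp only [hg, hef]
    rw [← hfsum, Finsupp.sum, sub_self]
  have hdiag : ∃ i, Φ i (τ j₀) (τ j₀) ∉ maximalIdeal R := by
    by_contra! hall
    have h1 := hK _ hsumK (τ j₀)
    rw [Pi.sub_apply, Pi.single_eq_same, Finset.sum_apply] at h1
    have h2 : ∑ i ∈ f.support, g i (τ j₀) (τ j₀) ∈ maximalIdeal R :=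
      Ideal.sum_mem _ fun i _ => hall i
    exact (maximalIdeal R).ne_top_iff_one.1 (Ideal.IsPrime.ne_top')
      ((Submodule.sub_mem_iff_right _ h2).1 h1)
  obtain ⟨i, hi⟩ := hdiag
  obtain ⟨hd, ht⟩ := hΦ (Φ i) (hpres i)
  let ρ : (ι → R) →ₗ[R] (Fin m → ResidueField R) :=
    LinearMap.pi fun j => Algebra.linearMap R (ResidueField R) ∘ₗ LinearMap.proj (τ j)
  have hρ : ∀ x j, ρ x j = residue R (x (τ j)) := fun x j => rfl
  have hker : K ≤ LinearMap.ker ρ := by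
    intro x hx
    rw [LinearMap.mem_ker]
    ext j
    rw [hρ, Pi.zero_apply, residue_eq_zero_iff]
    exact hK x hx _
  let A : Matrix (Fin m) (Fin m) (ResidueField R) :=
    Matrix.of fun j l => residue R (Φ i (τ j) (τ l))
  have hdet : A.det ≠ 0 := by
    rw [Matrix.det_of_isLowerTriangular A (fun j l hjl => ?_)]
    · refine Finset.prod_ne_zero_iff.2 fun j _ => ?_
      change residue R (Φ i (τ j) (τ j)) ≠ 0
      rw [Ne, residue_eq_zero_iff]
      exact fun hj => hi ((Submodule.sub_mem_iff_left _ hj).1 (hd j₀ j))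
    · exact (residue_eq_zero_iff _).2 (ht j l hjl)
  have hli : LinearIndependent (ResidueField R) A.col :=
    Matrix.linearIndependent_cols_of_det_ne_zero hdet
  obtain ⟨s, hs, hspan⟩ := hgen i
  have hcol : Set.range A.col ≤ Submodule.span (ResidueField R)
      ((s.image (K.liftQ ρ hker) : Finset _) : Set (Fin m → ResidueField R)) := by
    rintro _ ⟨l, rfl⟩
    have h1 : A.col l = K.liftQ ρ hker (e i (K.mkQ (Pi.single (τ l) 1))) := by
      rw [← hg]
      ext j
      simp [A, Matrix.col, Φ, hρ]
    have h2 : e i (K.mkQ (Pi.single (τ l) 1)) ∈ Submodule.span R (s : Set ((ι → R) ⧸ K)) := by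
      rw [hspan]
      exact Submodule.projection_apply_mem _ _
    have h3 := Submodule.mem_map_of_mem (f := K.liftQ ρ hker) h2
    rw [Submodule.map_span] at h3
    rw [h1, Finset.coe_image]
    exact Submodule.span_le_restrictScalars R (ResidueField R) _ h3
  have hle := linearIndependent_le_span_aux' A.col hli _ hcol
  rw [Fintype.card_fin] at hle
  refine hle.trans (le_trans ?_ hs)
  simpa using Finset.card_image_le

/-- Over a local ring of bounded module type, any two elements are comparable for divisibility. -/
lemma HasBoundedModuleType.dvd_total {R : Type u} [CommRing R] [IsLocalRing R] {n : ℕ}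
    (hb : HasBoundedModuleType R n) (a b : R) : a ∣ b ∨ b ∣ a := by
  by_contra! hab
  obtain ⟨hab, hba⟩ := hab
  set P := maximalIdeal R with hP
  have haP : a ∈ P := (mem_maximalIdeal _).2 fun hu => hab hu.dvd
  have hbP : b ∈ P := (mem_maximalIdeal _).2 fun hu => hba hu.dvd
  let I : Ideal R := Ideal.span {a} * P ⊔ Ideal.span {b} * P
  have hI : ∀ r s : R, a * r + b * s ∈ I → r ∈ P ∧ s ∈ P := by
    intro r s hrs
    obtain ⟨x, hx, y, hy, hxy⟩ := Submodule.mem_sup.1 hrs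
    obtain ⟨p, hp, rfl⟩ := Ideal.mem_span_singleton_mul.1 hx
    obtain ⟨q, hq, rfl⟩ := Ideal.mem_span_singleton_mul.1 hy
    have h1 : r - p ∈ P := (mem_maximalIdeal _).2 fun hu =>
      hba ((hu.dvd_mul_right).1 ⟨q - s, by linear_combination -hxy⟩)
    have h2 : s - q ∈ P := (mem_maximalIdeal _).2 fun hu =>
      hab ((hu.dvd_mul_right).1 ⟨p - r, by linear_combination -hxy⟩)
    exact ⟨(Submodule.sub_mem_iff_left _ hp).1 h1, (Submodule.sub_mem_iff_left _ hq).1 h2⟩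
  have hIP : I ≤ P := sup_le Ideal.mul_le_right Ideal.mul_le_right
  let K : Submodule R (Fin (n + 1) → R) :=
    { carrier := {x | ∃ t : ℕ → R, t 0 = 0 ∧ t (n + 1) = 0 ∧
        ∀ j : Fin (n + 1), x j - (a * t (j + 1) - b * t j) ∈ I}
      zero_mem' := ⟨0, by simp⟩
      add_mem' := by
        rintro x y ⟨t, h0, hN, ht⟩ ⟨t', h0', hN', ht'⟩
        refine ⟨t + t', by simp [h0, h0'], by simp [hN, hN'], fun j => ?_⟩
        convert I.add_mem (ht j) (ht' j) using 1
        simp only [Pi.add_apply]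
        ring
      smul_mem' := by
        rintro r x ⟨t, h0, hN, ht⟩
        refine ⟨r • t, by simp [h0], by simp [hN], fun j => ?_⟩
        convert I.mul_mem_left r (ht j) using 1
        simp only [Pi.smul_apply, smul_eq_mul]
        ring }
  have hK : ∀ x ∈ K, ∀ j, x j ∈ P := by
    rintro x ⟨t, -, -, ht⟩ j
    exact (Submodule.sub_mem_iff_left _ (P.sub_mem (P.mul_mem_right _ haP)
      (P.mul_mem_right _ hbP))).1 (hIP (ht j))
  refine absurd (hb.card_le K hK id fun Φ hΦ => ?_) (by omega)
  have hkey : ∀ i : Fin n, ∃ t : ℕ → R, t 0 = 0 ∧ ∀ j : Fin (n + 1),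
      Φ j i.castSucc - t (j + 1) ∈ P ∧ t j - Φ j i.succ ∈ P := by
    intro i
    have hmem : (a • Pi.single i.castSucc 1 - b • Pi.single i.succ 1 : Fin (n + 1) → R) ∈ K := by
      refine ⟨fun k => if k = i + 1 then 1 else 0, by simp, ?_, fun j => ?_⟩
      · simp only [ite_eq_right_iff]
        omega
      · convert I.zero_mem using 1
        simp [Pi.single_apply, Fin.ext_iff]
    obtain ⟨t, h0, -, ht⟩ := hΦ _ hmem
    refine ⟨t, h0, fun j => hI _ _ ?_⟩
    convert ht j using 1
    rw [Matrix.mulVec_sub, Matrix.mulVec_smul, Matrix.mulVec_smul, Matrix.mulVec_single_one,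
      Matrix.mulVec_single_one]
    simp only [Pi.sub_apply, Pi.smul_apply, Matrix.col_apply, smul_eq_mul]
    ring
  have hstep : ∀ i j : Fin n, Φ j.succ i.succ - Φ j.castSucc i.castSucc ∈ P := by
    intro i j
    obtain ⟨t, -, ht⟩ := hkey i
    have h1 := P.add_mem (ht j.castSucc).1 (ht j.succ).2
    rw [Fin.val_castSucc, Fin.val_succ, sub_add_sub_cancel] at h1
    rw [← neg_sub]
    exact P.neg_mem h1
  have hdiag : ∀ j : Fin (n + 1), Φ j j - Φ 0 0 ∈ P := by
    intro j
    induction j using Fin.induction with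
    | zero => simp
    | succ j ih => simpa using P.add_mem (hstep j j) ih
  have hupper : ∀ j l : Fin (n + 1), j < l → Φ j l ∈ P := by
    intro j
    induction j using Fin.induction with
    | zero =>
      intro l hl
      obtain ⟨i, rfl⟩ := Fin.exists_succ_eq.2 hl.ne'
      obtain ⟨t, h0, ht⟩ := hkey i
      simpa [h0] using (ht 0).2
    | succ j ih =>
      intro l hl
      obtain ⟨i, rfl⟩ := Fin.exists_succ_eq.2 ((Fin.zero_le _).trans_lt hl).ne'
      have h1 := ih i.castSucc (by simpa using hl)
      simpa using P.add_mem (hstep i j) h1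
  exact ⟨fun j l => sub_sub_sub_cancel_right (Φ j j) (Φ l l) (Φ 0 0) ▸
    P.sub_mem (hdiag j) (hdiag l), hupper⟩

lemma isChainRing_of_dvd_total {R : Type u} [CommRing R] (h : ∀ a b : R, a ∣ b ∨ b ∣ a) :
    IsChainRing R := by
  intro I J
  by_contra! hIJ
  obtain ⟨a, haI, haJ⟩ := SetLike.not_le_iff_exists.1 hIJ.1
  obtain ⟨b, hbJ, hbI⟩ := SetLike.not_le_iff_exists.1 hIJ.2
  rcases h a b with hab | hab
  · exact hbI (I.mem_of_dvd hab haI)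
  · exact haJ (J.mem_of_dvd hab hbJ)

section Divisibility

variable {R : Type u} [CommRing R] [IsLocalRing R]

lemma dvd_of_mul_dvd_mul_of_total (hd : ∀ a b : R, a ∣ b ∨ b ∣ a) {s x y : R} (h0 : s * x ≠ 0)
    (h : s * x ∣ s * y) : x ∣ y := by
  rcases hd x y with hxy | ⟨p, rfl⟩
  · exact hxy
  · obtain ⟨t, ht⟩ := h
    by_cases hp : IsUnit p
    · exact hp.mul_right_dvd.2 dvd_rfl
    · refine absurd ?_ h0
      have h1 : IsUnit (1 - p * t) :=
        isUnit_one_sub_self_of_mem_nonunits _ fun hu => hp (isUnit_of_mul_isUnit_left hu)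
      refine h1.mul_left_eq_zero.1 ?_
      linear_combination p * ht

lemma exists_eq_mul_of_not_dvd (hd : ∀ a b : R, a ∣ b ∨ b ∣ a) {x y : R} (h : ¬x ∣ y) :
    ∃ p ∈ maximalIdeal R, x = y * p := by
  obtain ⟨p, rfl⟩ := (hd x y).resolve_left h
  exact ⟨p, (mem_maximalIdeal _).2 fun hp => h (hp.mul_right_dvd.2 dvd_rfl), rfl⟩

end Divisibility

/-- A family of cosets `z i + (α i)` decreasing in `i`, with empty intersection, all of whose ideals
contain a given nonzero element `c`. -/
structure IsDivergentSystem {R : Type u} [CommRing R] {ι : Type u} [LinearOrder ι]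
    (z α : ι → R) (c : R) : Prop where
  dvd_of_le : ∀ {i k}, i ≤ k → α i ∣ α k
  dvd_sub_of_le : ∀ {i k}, i ≤ k → α i ∣ z k - z i
  no_limit : ∀ v, ¬∀ i, α i ∣ v - z i
  dvd_bound : ∀ i, α i ∣ c
  bound_ne_zero : c ≠ 0

namespace IsDivergentSystem

variable {R : Type u} [CommRing R] {ι : Type u} [LinearOrder ι] {z α : ι → R} {c : R}

lemma nonempty (h : IsDivergentSystem z α c) : Nonempty ι := by
  by_contra hι
  rw [not_nonempty_iff] at hι
  exact h.no_limit 0 fun i => hι.elim i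

lemma exists_lt_not_dvd (h : IsDivergentSystem z α c) (i : ι) : ∃ k, i < k ∧ ¬α k ∣ α i := by
  by_contra! hk
  refine h.no_limit (z i) fun k => ?_
  rcases le_or_gt k i with hki | hik
  · exact h.dvd_sub_of_le hki
  · rw [← neg_sub, dvd_neg]
    exact (hk k hik).trans (h.dvd_sub_of_le hik.le)

lemma mem_maximalIdeal_bound [IsLocalRing R] (h : IsDivergentSystem z α c) :
    c ∈ maximalIdeal R := by
  obtain ⟨i⟩ := h.nonempty
  obtain ⟨k, -, hk⟩ := h.exists_lt_not_dvd i
  exact (mem_maximalIdeal _).2 fun hu => hk (isUnit_of_dvd_unit (h.dvd_bound k) hu).dvd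

/-- Discarding the indices below `i₀` and translating by `a`. -/
lemma restrict (h : IsDivergentSystem z α c) (i₀ : ι) (a : R) :
    IsDivergentSystem (fun i => z (max i₀ i) - a) (fun i => α (max i₀ i)) c where
  dvd_of_le hik := h.dvd_of_le (max_le_max le_rfl hik)
  dvd_sub_of_le hik := by
    rw [sub_sub_sub_cancel_right]
    exact h.dvd_sub_of_le (max_le_max le_rfl hik)
  no_limit v hv := by
    refine h.no_limit (v + a) fun i => ?_
    have h1 := (h.dvd_of_le (le_max_right i₀ i)).trans (hv i)
    convert dvd_add h1 (h.dvd_sub_of_le (le_max_right i₀ i)) using 1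
    ring
  dvd_bound i := h.dvd_bound _
  bound_ne_zero := h.bound_ne_zero

lemma ne_zero (h : IsDivergentSystem z α c) (i : ι) : α i ≠ 0 := fun h0 =>
  h.bound_ne_zero (zero_dvd_iff.1 (h0 ▸ h.dvd_bound i))

/-- Changing the bound. -/
lemma of_bound (h : IsDivergentSystem z α c) {c' : R} (hc : ∀ i, α i ∣ c') (h0 : c' ≠ 0) :
    IsDivergentSystem z α c' :=
  ⟨h.dvd_of_le, h.dvd_sub_of_le, h.no_limit, hc, h0⟩

/-- Discarding the indices below `i₀`, translating by `z i₀` and dividing by `α i₀`. -/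
lemma rescale [IsLocalRing R] (hd : ∀ a b : R, a ∣ b ∨ b ∣ a) (h : IsDivergentSystem z α c)
    (i₀ : ι) : ∃ (w β : ι → R) (d : R), IsDivergentSystem w β d ∧
      ∀ i, α (max i₀ i) = α i₀ * β i := by
  choose w hw using fun i => h.dvd_sub_of_le (le_max_left i₀ i)
  choose β hβ using fun i => h.dvd_of_le (le_max_left i₀ i)
  obtain ⟨d, hcd⟩ := h.dvd_bound i₀
  refine ⟨w, β, d, ⟨fun {i k} hik => ?_, fun {i k} hik => ?_, fun v hv => ?_, fun i => ?_, ?_⟩, hβ⟩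
  · refine dvd_of_mul_dvd_mul_of_total hd (s := α i₀) (hβ i ▸ h.ne_zero _) ?_
    rw [← hβ, ← hβ]
    exact h.dvd_of_le (max_le_max le_rfl hik)
  · refine dvd_of_mul_dvd_mul_of_total hd (s := α i₀) (hβ i ▸ h.ne_zero _) ?_
    rw [← hβ, mul_sub, ← hw, ← hw, sub_sub_sub_cancel_right]
    exact h.dvd_sub_of_le (max_le_max le_rfl hik)
  · refine (h.restrict i₀ (z i₀)).no_limit (α i₀ * v) fun i => ?_
    rw [hβ, hw, ← mul_sub]
    exact mul_dvd_mul_left _ (hv i)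
  · refine dvd_of_mul_dvd_mul_of_total hd (s := α i₀) (hβ i ▸ h.ne_zero _) ?_
    rw [← hβ, ← hcd]
    exact h.dvd_bound _
  · rintro rfl
    exact h.bound_ne_zero (by rw [hcd, mul_zero])

end IsDivergentSystem

/-- A divergent system on which multiplication by `s` does not move the ideals `(α i)` past all of
the later ones does not exist over a local ring of bounded module type; normalized form. -/
lemma IsDivergentSystem.false_of_mul_dvd_aux {R : Type u} [CommRing R] [IsLocalRing R] {n : ℕ}
    (hb : HasBoundedModuleType R n) {ι : Type u} [LinearOrder ι] {u α : ι → R} {c : R}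
    (h : IsDivergentSystem u α c) {s : R} (hs : s ∈ maximalIdeal R)
    (hc : s ^ (2 * (n + 1)) * c ≠ 0) (hu : ∀ i, s ^ (2 * (n + 1)) ∣ u i)
    (hα : ∀ i, ∃ k, s ^ (2 * (n + 1)) * α i ∣ α k) : False := by
  have hd := hb.dvd_total
  set P := maximalIdeal R with hP
  set p := n + 1 with hp
  let cc : Fin p → R := fun j => s ^ (2 * (j : ℕ)) * c
  have hcc : ∀ j, cc j ∣ s ^ (2 * p) * c := fun j =>
    mul_dvd_mul_right (pow_dvd_pow _ (by omega)) _
  have hcc0 : ∀ j, cc j ≠ 0 := fun j h0 => hc (zero_dvd_iff.1 (h0 ▸ hcc j))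
  have hccP : ∀ j, cc j ∈ P := fun j => P.mul_mem_left _ h.mem_maximalIdeal_bound
  have hαc : ∀ i, α i ∣ s ^ (2 * p) * c := fun i => (h.dvd_bound i).mul_left _
  let Q : ι → (Option (Fin p) → R) → Prop := fun i v => s ^ (2 * p) * c ∣ v none * α i ∧
    ∀ j, cc j ∣ v (some j) + v none * u i * s ^ (j : ℕ)
  have hQmono : ∀ {i k v}, i ≤ k → Q i v → Q k v := by
    rintro i k v hik ⟨h1, h2⟩
    refine ⟨h1.trans (mul_dvd_mul_left _ (h.dvd_of_le hik)), fun j => ?_⟩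
    have h3 : s ^ (2 * p) * c ∣ v none * (u k - u i) :=
      h1.trans (mul_dvd_mul_left _ (h.dvd_sub_of_le hik))
    convert dvd_add (h2 j) (((hcc j).trans h3).mul_right (s ^ (j : ℕ))) using 1
    ring
  obtain ⟨i₀⟩ := h.nonempty
  let K : Submodule R (Option (Fin p) → R) :=
    { carrier := {v | ∃ i, Q i v}
      zero_mem' := ⟨i₀, by simp [Q]⟩
      add_mem' := by
        rintro v w ⟨i, hi⟩ ⟨k, hk⟩
        obtain ⟨h1, h2⟩ := hQmono (le_max_left i k) hi
        obtain ⟨h3, h4⟩ := hQmono (le_max_right i k) hk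
        refine ⟨max i k, ?_, fun j => ?_⟩
        · rw [Pi.add_apply, add_mul]
          exact dvd_add h1 h3
        · convert dvd_add (h2 j) (h4 j) using 1
          simp only [Pi.add_apply]
          ring
      smul_mem' := by
        rintro r v ⟨i, h1, h2⟩
        refine ⟨i, ?_, fun j => ?_⟩
        · rw [Pi.smul_apply, smul_eq_mul, mul_assoc]
          exact h1.mul_left r
        · convert (h2 j).mul_left r using 1
          simp only [Pi.smul_apply, smul_eq_mul]
          ring }
  have hKnone : ∀ v ∈ K, v none ∈ P := by
    rintro v ⟨i, h1, -⟩
    refine (mem_maximalIdeal _).2 fun hv => ?_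
    obtain ⟨k, -, hk⟩ := h.exists_lt_not_dvd i
    exact hk ((hαc k).trans (hv.dvd_mul_left.1 h1))
  have hK : ∀ v ∈ K, ∀ j, v j ∈ P := by
    intro v hv j
    cases j with
    | none => exact hKnone v hv
    | some j =>
      obtain ⟨i, -, h2⟩ := id hv
      refine (Submodule.add_mem_iff_left _ ?_).1 (P.mem_of_dvd (h2 j) (hccP j))
      exact P.mul_mem_right _ (P.mul_mem_right _ (hKnone v hv))
  refine absurd (hb.card_le K hK (some ∘ Fin.rev) fun Φ hΦ => ?_) (by omega)
  have hoff : ∀ i j : Fin p, i < j → s ^ (2 * (j - i : ℕ)) ∣ Φ (some j) (some i) := by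
    intro i j hij
    have hmem : (cc i • Pi.single (some i) 1 : Option (Fin p) → R) ∈ K := by
      refine ⟨i₀, by simp, fun j => ?_⟩
      by_cases hij : j = i
      · simp [hij]
      · simp [hij]
    obtain ⟨k, -, hk⟩ := hΦ _ hmem
    have h1 := hk j
    rw [Matrix.mulVec_smul, Matrix.mulVec_single_one] at h1
    simp only [Pi.smul_apply, Matrix.col_apply, smul_eq_mul] at h1
    have h2 : cc j = cc i * s ^ (2 * (j - i : ℕ)) := by
      simp only [cc]
      rw [mul_right_comm, ← pow_add]
      congr 2
      omega
    have h3 : s ^ (2 * (j - i : ℕ)) ∣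
        Φ (some j) (some i) + Φ none (some i) * (u k * s ^ (j : ℕ)) := by
      refine dvd_of_mul_dvd_mul_of_total hd (h2 ▸ hcc0 j) ?_
      rw [← h2]
      convert h1 using 1
      ring
    refine (dvd_add_left (Dvd.dvd.mul_left (Dvd.dvd.mul_right ?_ _) _)).1 h3
    exact (pow_dvd_pow _ (by omega)).trans (hu k)
  have hη : ∀ j : Fin p, ∃ w, ∑ l : Fin p, Φ (some j) (some l) * s ^ (l : ℕ) =
      s ^ (j : ℕ) * (Φ (some j) (some j) + s * w) := by
    intro j
    have h1 : s ^ (j : ℕ) * s ∣ ∑ l ∈ Finset.univ.erase j,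
        Φ (some j) (some l) * s ^ (l : ℕ) := by
      refine Finset.dvd_sum fun l hl => ?_
      rw [← pow_succ]
      rcases lt_or_gt_of_ne (Finset.ne_of_mem_erase hl) with hlj | hjl
      · refine (pow_dvd_pow s ?_).trans
          ((pow_add s (2 * (j - l : ℕ)) l).dvd.trans (mul_dvd_mul_right (hoff l j hlj) _))
        omega
      · exact (pow_dvd_pow s hjl).mul_left _
    obtain ⟨w, hw⟩ := h1
    refine ⟨w, ?_⟩
    rw [← Finset.add_sum_erase _ _ (Finset.mem_univ j), hw]
    ring
  choose w hw using hη
  have hlim : ∀ i, ∃ μ, ∀ j : Fin p, α i ∣ s ^ (2 * p - j : ℕ) * Φ (some j) none -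
      s ^ (2 * p) * u i * (Φ (some j) (some j) + s * w j - μ) := by
    intro i
    obtain ⟨r, hr⟩ := hαc i
    let x : Option (Fin p) → R := fun o => o.elim r fun l => -(r * u i * s ^ (l : ℕ))
    have hmem : x ∈ K := ⟨i, (hr.trans (mul_comm _ _)).dvd, fun j => by simp [x]⟩
    obtain ⟨k, hk⟩ := hΦ _ hmem
    obtain ⟨-, hk⟩ := hQmono (le_max_right i k) hk
    let lam : Option (Fin p) → R := fun o =>
      Φ o none - u i * ∑ l : Fin p, Φ o (some l) * s ^ (l : ℕ)
    have hlam : ∀ o, Φ.mulVec x o = r * lam o := by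
      intro o
      simp only [Matrix.mulVec, dotProduct, Fintype.sum_option, x, lam, Option.elim, mul_sub,
        Finset.mul_sum]
      rw [sub_eq_add_neg, ← Finset.sum_neg_distrib]
      congr 1
      · ring
      · exact Finset.sum_congr rfl fun l _ => by ring
    refine ⟨lam none, fun j => ?_⟩
    have h1 := hk j
    rw [hlam, hlam] at h1
    simp only [lam] at h1
    rw [hw j] at h1
    change cc j ∣ r * _ + r * lam none * _ * _ at h1
    have h2 : s ^ (2 * p) * c ∣ r * (u (max i k) - u i) := by
      rw [hr, mul_comm]
      exact mul_dvd_mul_left _ (h.dvd_sub_of_le (le_max_left i k))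
    have h3 : cc j ∣ r * (Φ (some j) none -
        s ^ (j : ℕ) * u i * (Φ (some j) (some j) + s * w j - lam none)) := by
      convert dvd_sub h1 (((hcc j).trans h2).mul_right (lam none * s ^ (j : ℕ))) using 1
      ring
    have h4 : s ^ (2 * p) * c = s ^ (2 * (p - j) : ℕ) * cc j := by
      simp only [cc]
      rw [← mul_assoc, ← pow_add]
      congr 2
      omega
    have h5 : r * α i ∣ r * (s ^ (2 * (p - j) : ℕ) * (Φ (some j) none -
        s ^ (j : ℕ) * u i * (Φ (some j) (some j) + s * w j - lam none))) := by
      rw [mul_comm r, ← hr, h4, mul_left_comm r]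
      exact mul_dvd_mul_left _ h3
    have h6 := dvd_of_mul_dvd_mul_of_total hd (by rwa [mul_comm, ← hr]) h5
    convert h6.mul_left (s ^ (j : ℕ)) using 1
    have h7 : s ^ (2 * p - j : ℕ) = s ^ (j : ℕ) * s ^ (2 * (p - j) : ℕ) := by
      rw [← pow_add]
      congr 1
      omega
    have h8 : s ^ (2 * p) = s ^ (2 * p - j : ℕ) * s ^ (j : ℕ) := by
      rw [← pow_add]
      congr 1
      omega
    rw [h8, h7]
    ring
  refine ⟨fun j l => ?_, fun j l hjl => ?_⟩
  · simp only [Function.comp]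
    generalize Fin.rev j = j
    generalize Fin.rev l = l
    refine (mem_maximalIdeal _).2 fun hu' => ?_
    have hu2 : IsUnit (Φ (some j) (some j) + s * w j - (Φ (some l) (some l) + s * w l)) := by
      by_contra hn
      refine (mem_maximalIdeal _).1 ?_ hu'
      have h1 := P.sub_mem ((mem_maximalIdeal _).2 hn) (P.mul_mem_right (w j - w l) hs)
      convert h1 using 1
      ring
    obtain ⟨ε, hε⟩ := hu2
    let v := (ε⁻¹ : Rˣ) * (s ^ (2 * p - j : ℕ) * Φ (some j) none -
      s ^ (2 * p - l : ℕ) * Φ (some l) none)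
    have hv : ∀ i, α i ∣ v - s ^ (2 * p) * u i := by
      intro i
      obtain ⟨μ, hμ⟩ := hlim i
      convert (dvd_sub (hμ j) (hμ l)).mul_left (ε⁻¹ : Rˣ).val using 1
      have h1 : (ε⁻¹ : Rˣ).val * ε = 1 := ε.inv_mul
      simp only [v]
      linear_combination -(s ^ (2 * p) * u i) * (ε⁻¹ : Rˣ).val * hε + s ^ (2 * p) * u i * h1
    obtain ⟨k₀, hk₀⟩ := hα i₀
    obtain ⟨v', hv'⟩ : s ^ (2 * p) ∣ v := by
      have h1 := ((dvd_mul_right _ _).trans hk₀).trans (hv k₀)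
      exact (dvd_sub_left (dvd_mul_right _ _)).1 h1
    refine h.no_limit v' fun i => ?_
    obtain ⟨k, hk⟩ := hα i
    have hik : α i ∣ α (max i k) := h.dvd_of_le (le_max_left i k)
    have h1 := (hk.trans (h.dvd_of_le (le_max_right i k))).trans (hv (max i k))
    rw [hv', ← mul_sub] at h1
    have h2 : s ^ (2 * p) * α i ≠ 0 := fun h0 => h.ne_zero k (zero_dvd_iff.1 (h0 ▸ hk))
    convert dvd_add (dvd_of_mul_dvd_mul_of_total hd h2 h1)
      (h.dvd_sub_of_le (le_max_left i k)) using 1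
    ring
  · refine P.mem_of_dvd (hoff _ _ (Fin.rev_lt_rev.2 hjl)) (P.pow_mem_of_mem hs _ ?_)
    have := Fin.lt_def.1 (Fin.rev_lt_rev.2 hjl)
    omega

/-- Over a local ring of bounded module type, no divergent system has the property that each
`s * α i` divides some `α k`, for a fixed `s` in the maximal ideal. -/
lemma IsDivergentSystem.false_of_mul_dvd {R : Type u} [CommRing R] [IsLocalRing R] {n : ℕ}
    (hb : HasBoundedModuleType R n) {ι : Type u} [LinearOrder ι] {z α : ι → R} {c : R}
    (h : IsDivergentSystem z α c) {s : R} (hs : s ∈ maximalIdeal R)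
    (hα : ∀ i, ∃ k, s * α i ∣ α k) : False := by
  have hpow : ∀ (e : ℕ) i, ∃ k, s ^ e * α i ∣ α k := by
    intro e
    induction e with
    | zero => exact fun i => ⟨i, by simp⟩
    | succ e ih =>
      intro i
      obtain ⟨k, hk⟩ := ih i
      obtain ⟨l, hl⟩ := hα k
      refine ⟨l, ?_⟩
      rw [pow_succ', mul_assoc]
      exact (mul_dvd_mul_left s hk).trans hl
  obtain ⟨i₀⟩ := h.nonempty
  obtain ⟨k₀, hk₀⟩ := hpow (2 * (n + 1)) i₀
  have hs₀ : s ^ (2 * (n + 1)) ∣ α k₀ := (dvd_mul_right _ _).trans hk₀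
  obtain ⟨d, hd⟩ := hs₀.trans (h.dvd_bound k₀)
  have hαd : ∀ i, α i ∣ d := by
    intro i
    obtain ⟨k, hk⟩ := hpow (2 * (n + 1)) i
    exact dvd_of_mul_dvd_mul_of_total hb.dvd_total
      (fun h0 => h.ne_zero k (zero_dvd_iff.1 (h0 ▸ hk))) (hd ▸ hk.trans (h.dvd_bound k))
  refine ((h.restrict k₀ (z k₀)).of_bound (fun i => hαd _) ?_).false_of_mul_dvd_aux hb hs
    (hd ▸ h.bound_ne_zero) (fun i => hs₀.trans (h.dvd_sub_of_le (le_max_left _ _))) fun i => ?_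
  · rintro rfl
    exact h.bound_ne_zero (by rw [hd, mul_zero])
  · obtain ⟨k, hk⟩ := hpow (2 * (n + 1)) (max k₀ i)
    exact ⟨k, hk.trans (h.dvd_of_le (le_max_right _ _))⟩

/-- Every family of cosets of ideals of `R` indexed by `ι` which has the finite intersection
property, and whose ideals have a nonzero common element, has nonempty intersection. -/
def HasCosetIntersections (R ι : Type u) [CommRing R] : Prop :=
  ∀ (a : ι → R) (A : ι → Ideal R), (∃ c ≠ 0, ∀ i, c ∈ A i) →
    (∀ s : Finset ι, ∃ x : R, ∀ i ∈ s, x - a i ∈ A i) → ∃ x : R, ∀ i, x - a i ∈ A i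

lemma exists_forall_mem_finset_of_forall_le {R ι : Type u} [CommRing R] [LinearOrder ι]
    {a : ι → R} {A : ι → Ideal R} (h : ∀ i k, i < k → a k - a i ∈ A i) (s : Finset ι) :
    ∃ x : R, ∀ i ∈ s, x - a i ∈ A i := by
  rcases s.eq_empty_or_nonempty with rfl | hs
  · exact ⟨0, by simp⟩
  · refine ⟨a (s.max' hs), fun i hi => ?_⟩
    rcases (s.le_max' i hi).eq_or_lt with h1 | h1
    · rw [← h1, sub_self]
      exact zero_mem _
    · exact h _ _ h1

/-- A cocycle modulo a decreasing well-ordered family of ideals is a coboundary, provided that the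
shorter families of cosets have nonempty intersections. -/
lemma exists_coboundary {R ι : Type u} [CommRing R] [LinearOrder ι] [WellFoundedLT ι]
    (hι : ∀ i : ι, HasCosetIntersections R (Set.Iio i)) {I : ι → Ideal R} {c : R} (hc : c ≠ 0)
    (hcI : ∀ i, c ∈ I i) {e : ι → ι → R}
    (he : ∀ i j k, i < j → j < k → e i k - e i j - e j k ∈ I i) :
    ∃ h : ι → R, ∀ i k, i < k → h k - h i - e i k ∈ I i := by
  classical
  let step : ∀ k : ι, (∀ i, i < k → R) → R := fun k f =>
    if hx : ∃ x, ∀ i (hi : i < k), x - f i hi - e i k ∈ I i then hx.choose else 0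
  let h : ι → R := wellFounded_lt.fix step
  have hfix : ∀ k, h k = step k fun i _ => h i := fun k => wellFounded_lt.fix_eq step k
  have main : ∀ k i, i < k → h k - h i - e i k ∈ I i := by
    intro k
    induction k using WellFoundedLT.induction with
    | ind k ih =>
      have hx : ∃ x, ∀ i, i < k → x - h i - e i k ∈ I i := by
        obtain ⟨x, hx⟩ := hι k (fun i => h i + e i k) (fun i => I i) ⟨c, hc, fun i => hcI i⟩
          (exists_forall_mem_finset_of_forall_le fun i j hij => by
            convert (I i).sub_mem (ih j j.2 i hij) (he i j k hij j.2) using 1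
            ring)
        exact ⟨x, fun i hi => by simpa only [sub_sub] using hx ⟨i, hi⟩⟩
      intro i hi
      rw [hfix k]
      simp only [step]
      rw [dif_pos hx]
      exact hx.choose_spec i hi
  exact ⟨h, fun i k => main k i⟩

section PowerSeries

open PowerSeries

variable {R : Type u} [CommRing R]

lemma constantCoeff_units_inv {S : R⟦X⟧ˣ} (hS : constantCoeff (S : R⟦X⟧) = 1) :
    constantCoeff (S⁻¹ : R⟦X⟧ˣ).val = 1 := by
  have h := congrArg constantCoeff S.mul_inv
  rwa [map_mul, hS, one_mul, map_one] at h

lemma coeff_one_mul_of_constantCoeff {U V : R⟦X⟧} (hU : constantCoeff U = 1)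
    (hV : constantCoeff V = 1) : coeff 1 (U * V) = coeff 1 U + coeff 1 V := by
  rw [coeff_mul, Finset.Nat.antidiagonal_succ, Finset.sum_cons]
  simp [hU, hV, add_comm]

/-- If `β ^ d` divides the coefficient of degree `d` of a unit with constant coefficient `1`, for
`d ≤ m`, then the same holds for the inverse. -/
lemma pow_dvd_coeff_units_inv {β : R} {m : ℕ} {S : R⟦X⟧ˣ} (hS : constantCoeff (S : R⟦X⟧) = 1)
    (h : ∀ d ≤ m, β ^ d ∣ coeff d (S : R⟦X⟧)) (d : ℕ) (hd : d ≤ m) :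
    β ^ d ∣ coeff d (S⁻¹ : R⟦X⟧ˣ).val := by
  induction d using Nat.strong_induction_on with
  | _ d ih =>
    rcases d with _ | d
    · simp
    · have h1 := congrArg (coeff (d + 1)) S.mul_inv
      rw [coeff_mul, Finset.Nat.antidiagonal_succ, Finset.sum_cons, coeff_one] at h1
      simp only [coeff_zero_eq_constantCoeff, hS, one_mul, Finset.sum_map] at h1
      rw [if_neg (Nat.succ_ne_zero d)] at h1
      rw [eq_neg_of_add_eq_zero_left h1, dvd_neg]
      refine Finset.dvd_sum fun x hx => ?_
      have hx' : x.1 + x.2 = d := by simpa using hx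
      have h2 : β ^ (d + 1) = β ^ (x.1 + 1) * β ^ x.2 := by
        rw [← pow_add]
        congr 1
        omega
      rw [h2]
      exact mul_dvd_mul (h (x.1 + 1) (by omega)) (ih x.2 (by omega) (by omega))

/-- If `β ^ d` divides the coefficients of degree `d ≤ l` of `U` and `V`, then the coefficient of
degree `l + 1` of the product is additive modulo `β ^ (l + 1)`. -/
lemma pow_dvd_coeff_succ_mul_sub {β : R} {l : ℕ} {U V : R⟦X⟧} (hU : constantCoeff U = 1)
    (hV : constantCoeff V = 1) (hUl : ∀ d ≤ l, β ^ d ∣ coeff d U)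
    (hVl : ∀ d ≤ l, β ^ d ∣ coeff d V) :
    β ^ (l + 1) ∣ coeff (l + 1) (U * V) - coeff (l + 1) U - coeff (l + 1) V := by
  have h0 : ((0, l + 1) : ℕ × ℕ) ≠ (l + 1, 0) := by simp
  rw [coeff_mul, ← Finset.add_sum_erase _ _ (a := ((0, l + 1) : ℕ × ℕ)) (by simp),
    ← Finset.add_sum_erase _ _ (a := ((l + 1, 0) : ℕ × ℕ)) (by simp)]
  simp only [coeff_zero_eq_constantCoeff, hU, hV, one_mul, mul_one]
  rw [show ∀ a b s : R, a + (b + s) - b - a = s from fun a b s => by ring]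
  refine Finset.dvd_sum fun x hx => ?_
  simp only [Finset.mem_erase, Finset.HasAntidiagonal.mem_antidiagonal, Ne, Prod.ext_iff,
    not_and] at hx
  have h2 : β ^ (l + 1) = β ^ x.1 * β ^ x.2 := by
    rw [← pow_add, hx.2.2]
  rw [h2]
  exact mul_dvd_mul (hUl _ (by omega)) (hVl _ (by omega))

/-- The unit `1 + a X ^ (l + 1)` of the ring of power series. -/
lemma exists_units_one_add_mul_X_pow (a : R) (l : ℕ) :
    ∃ V : R⟦X⟧ˣ, (V : R⟦X⟧) = 1 + C a * X ^ (l + 1) := by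
  have h : IsUnit (1 + C a * X ^ (l + 1) : R⟦X⟧) := by
    rw [isUnit_iff_constantCoeff]
    simp
  exact ⟨h.unit, rfl⟩

end PowerSeries

section UnitFamily

open PowerSeries

variable {R ι : Type u} [CommRing R] [LinearOrder ι] [WellFoundedLT ι]

/-- A divergent system lifts to a system of unit power series, the coefficients of degree `d` of
the quotients being divisible by the powers of exponent `d` of the members of the system. -/
lemma IsDivergentSystem.exists_units (hι : ∀ i : ι, HasCosetIntersections R (Set.Iio i))
    {z α : ι → R} {c : R} (h : IsDivergentSystem z α c) {m : ℕ} (hm : ∀ i, α i ^ m ∣ c)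
    (l : ℕ) (hl : l + 1 ≤ m) :
    ∃ S : ι → R⟦X⟧ˣ, (∀ i, constantCoeff (S i : R⟦X⟧) = 1) ∧
      (∀ i, coeff 1 (S i : R⟦X⟧) = z i) ∧
      ∀ i k, i < k → ∀ d ≤ l + 1, α i ^ d ∣ coeff d ((S i)⁻¹ * S k : R⟦X⟧ˣ).val := by
  induction l with
  | zero =>
    choose S hS using fun i => exists_units_one_add_mul_X_pow (z i) 0
    have h1 : ∀ i, constantCoeff (S i : R⟦X⟧) = 1 := fun i => by simp [hS]
    have h2 : ∀ i, coeff 1 (S i : R⟦X⟧) = z i := fun i => by simp [hS, coeff_one]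
    refine ⟨S, h1, h2, fun i k hik d hd => ?_⟩
    obtain rfl | rfl : d = 0 ∨ d = 1 := by omega
    · simp
    · have h3 := coeff_one_mul_of_constantCoeff (h1 i) (constantCoeff_units_inv (h1 i))
      rw [Units.mul_inv, coeff_one, if_neg one_ne_zero, h2] at h3
      rw [Units.val_mul, coeff_one_mul_of_constantCoeff (constantCoeff_units_inv (h1 i)) (h1 k),
        h2, eq_neg_of_add_eq_zero_right h3.symm, pow_one, neg_add_eq_sub]
      exact h.dvd_sub_of_le hik.le
  | succ l ih =>
    obtain ⟨S, h1, h2, h3⟩ := ih (by omega)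
    have hg : ∀ i k, constantCoeff ((S i)⁻¹ * S k : R⟦X⟧ˣ).val = 1 := fun i k => by
      rw [Units.val_mul, map_mul, constantCoeff_units_inv (h1 i), h1, one_mul]
    obtain ⟨a, ha⟩ := exists_coboundary hι (I := fun i => Ideal.span {α i ^ (l + 2)})
      h.bound_ne_zero
      (fun i => Ideal.mem_span_singleton.2 ((pow_dvd_pow _ hl).trans (hm i)))
      (e := fun i k => -coeff (l + 2) ((S i)⁻¹ * S k : R⟦X⟧ˣ).val) (fun i j k hij hjk => by
        rw [Ideal.mem_span_singleton]
        have h4 := pow_dvd_coeff_succ_mul_sub (hg i j) (hg j k) (h3 i j hij) (fun d hd =>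
          (pow_dvd_pow_of_dvd (h.dvd_of_le hij.le) d).trans (h3 j k hjk d hd))
        rw [← Units.val_mul, mul_assoc, mul_inv_cancel_left] at h4
        rw [← dvd_neg]
        convert h4 using 1
        ring)
    choose V hV using fun i => exists_units_one_add_mul_X_pow (a i) (l + 1)
    have hV0 : ∀ i, constantCoeff (V i : R⟦X⟧) = 1 := fun i => by simp [hV]
    refine ⟨fun i => S i * V i, fun i => ?_, fun i => ?_, fun i k hik d hd => ?_⟩
    · rw [Units.val_mul, map_mul, h1, hV0, one_mul]
    · rw [Units.val_mul, coeff_one_mul_of_constantCoeff (h1 i) (hV0 i), h2, hV]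
      simp [coeff_one, coeff_X_pow]
    · have h4 : ((S i * V i)⁻¹ * (S k * V k) : R⟦X⟧ˣ).val = ((S i)⁻¹ * S k : R⟦X⟧ˣ).val +
          C (a k - a i) * (((S i)⁻¹ * S k : R⟦X⟧ˣ).val * (V i)⁻¹.val * X ^ (l + 2)) := by
        have h5 : (V k : R⟦X⟧) = (V i).val + C (a k - a i) * X ^ (l + 2) := by
          rw [hV, hV, map_sub]
          ring
        have h6 : ((S i * V i)⁻¹ * (S k * V k) : R⟦X⟧ˣ) =
            ((S i)⁻¹ * S k) * ((V i)⁻¹ * V k) := by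
          rw [mul_inv]
          exact mul_mul_mul_comm _ _ _ _
        rw [h6, Units.val_mul, Units.val_mul (V i)⁻¹, h5, mul_add, Units.inv_mul, mul_add, mul_one]
        ring
      change _ ∣ coeff d ((S i * V i)⁻¹ * (S k * V k) : R⟦X⟧ˣ).val
      rw [h4, map_add, coeff_C_mul, coeff_mul_X_pow']
      rcases hd.lt_or_eq with hd | rfl
      · rw [if_neg (by omega), mul_zero, add_zero]
        exact h3 i k hik d (by omega)
      · rw [if_pos le_rfl, Nat.sub_self, coeff_zero_eq_constantCoeff_apply, map_mul, hg,
          constantCoeff_units_inv (hV0 i), one_mul, mul_one]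
        convert Ideal.mem_span_singleton.1 (ha i k hik) using 1
        ring

/-- Normalized form of `IsDivergentSystem.exists_units`, at the least index. -/
lemma IsDivergentSystem.exists_units_normalized
    (hι : ∀ i : ι, HasCosetIntersections R (Set.Iio i))
    {z α : ι → R} {c : R} (h : IsDivergentSystem z α c) {m : ℕ} (hm : ∀ i, α i ^ (m + 1) ∣ c)
    {i₀ : ι} (hi₀ : ∀ i, i₀ ≤ i) :
    ∃ S : ι → R⟦X⟧ˣ, (∀ i, constantCoeff (S i : R⟦X⟧) = 1) ∧
      (∀ i, coeff 1 (S i : R⟦X⟧) = z i - z i₀) ∧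
      (∀ i, ∀ d ≤ m + 1, α i₀ ^ d ∣ coeff d (S i : R⟦X⟧)) ∧
      ∀ i k, i ≤ k → ∀ d ≤ m + 1, α i ^ d ∣ coeff d ((S i)⁻¹ * S k : R⟦X⟧ˣ).val := by
  obtain ⟨S, h1, h2, h3⟩ := h.exists_units hι hm m le_rfl
  have h3' : ∀ i k, i ≤ k → ∀ d ≤ m + 1, α i ^ d ∣ coeff d ((S i)⁻¹ * S k : R⟦X⟧ˣ).val := by
    intro i k hik d hd
    rcases hik.eq_or_lt with rfl | hik
    · rw [inv_mul_cancel, Units.val_one, coeff_one]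
      split_ifs with h0
      · rw [h0, pow_zero]
      · exact dvd_zero _
    · exact h3 i k hik d hd
  have h4 := coeff_one_mul_of_constantCoeff (h1 i₀) (constantCoeff_units_inv (h1 i₀))
  rw [Units.mul_inv, coeff_one, if_neg one_ne_zero, h2] at h4
  refine ⟨fun i => (S i₀)⁻¹ * S i, fun i => ?_, fun i => ?_, fun i => h3' _ _ (hi₀ i), ?_⟩
  · rw [Units.val_mul, map_mul, constantCoeff_units_inv (h1 i₀), h1, one_mul]
  · rw [Units.val_mul, coeff_one_mul_of_constantCoeff (constantCoeff_units_inv (h1 i₀)) (h1 i),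
      h2, eq_neg_of_add_eq_zero_right h4.symm, neg_add_eq_sub]
  · intro i k hik
    have h5 : ((S i₀)⁻¹ * S i)⁻¹ * ((S i₀)⁻¹ * S k) = (S i)⁻¹ * S k := by group
    rw [h5]
    exact h3' i k hik

end UnitFamily

section Toeplitz

open PowerSeries

variable {R : Type u} [CommRing R]

/-- The matrix of multiplication by a power series `S` on power series truncated above degree
`m`. -/
noncomputable def toeplitzMatrix (m : ℕ) (S : R⟦X⟧) : Matrix (Fin (m + 1)) (Fin (m + 1)) R :=
  Matrix.of fun b c => coeff (b : ℕ) (S * X ^ (c : ℕ))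

lemma toeplitzMatrix_apply (m : ℕ) (S : R⟦X⟧) (b c : Fin (m + 1)) :
    toeplitzMatrix m S b c = if (c : ℕ) ≤ b then coeff (b - c : ℕ) S else 0 :=
  coeff_mul_X_pow' _ _ _

lemma toeplitzMatrix_one (m : ℕ) : toeplitzMatrix m (1 : R⟦X⟧) = 1 := by
  ext b c
  rw [toeplitzMatrix, Matrix.of_apply, one_mul, coeff_X_pow, Matrix.one_apply]
  simp only [Fin.ext_iff]

lemma toeplitzMatrix_mul (m : ℕ) (S U : R⟦X⟧) :
    toeplitzMatrix m (S * U) = toeplitzMatrix m S * toeplitzMatrix m U := by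
  ext b c
  rw [Matrix.mul_apply, toeplitzMatrix, Matrix.of_apply, mul_assoc, mul_comm, coeff_mul,
    Finset.Nat.sum_antidiagonal_eq_sum_range_succ
      fun e d => coeff e (U * X ^ (c : ℕ)) * coeff d S]
  have hU : ∀ e, toeplitzMatrix m U e c = coeff (e : ℕ) (U * X ^ (c : ℕ)) := fun _ => rfl
  simp only [toeplitzMatrix_apply m S, hU]
  rw [Fin.sum_univ_eq_sum_range fun e => (if e ≤ (b : ℕ) then coeff (b - e : ℕ) S else 0) *
    coeff e (U * X ^ (c : ℕ))]
  rw [← Finset.sum_subset (Finset.range_subset_range.2 (Nat.succ_le_of_lt b.2))]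
  · refine Finset.sum_congr rfl fun e he => ?_
    rw [if_pos (Nat.lt_succ_iff.1 (Finset.mem_range.1 he)), mul_comm]
  · intro e _ he
    rw [if_neg (fun h => he (Finset.mem_range.2 (Nat.lt_succ_of_le h))), zero_mul]

/-- Modulo an ideal containing the coefficients of degree at least `2`, the Toeplitz matrix of a
power series with constant coefficient `1` depends only on the coefficient of degree `1`. -/
lemma toeplitzMatrix_map_mk (m : ℕ) {S : R⟦X⟧} (J : Ideal R) (h0 : constantCoeff S = 1)
    (h2 : ∀ d ≤ m, 2 ≤ d → coeff d S ∈ J) :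
    (toeplitzMatrix m S).map (Ideal.Quotient.mk J) =
      1 + Ideal.Quotient.mk J (coeff 1 S) • toeplitzMatrix m X := by
  ext b c
  rw [Matrix.map_apply, Matrix.add_apply, Matrix.smul_apply, toeplitzMatrix_apply,
    toeplitzMatrix_apply, Matrix.one_apply, coeff_X]
  rcases lt_trichotomy (c : ℕ) b with h | h | h
  · rw [if_pos h.le, if_pos h.le, if_neg (fun h' => h.ne (congrArg Fin.val h'.symm)), zero_add]
    split_ifs with h1
    · rw [h1, smul_eq_mul, mul_one]
    · rw [smul_zero, Ideal.Quotient.eq_zero_iff_mem]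
      exact h2 _ (by omega) (by omega)
  · simp [← Fin.ext h, h0]
  · rw [if_neg h.not_ge, if_neg h.not_ge, if_neg (fun h' => h.ne (congrArg Fin.val h'))]
    simp

lemma toeplitzMatrix_X_mul_succ_castSucc {m : ℕ} (A : Matrix (Fin (m + 1)) (Fin (m + 1)) R)
    (a : Fin m) (c : Fin (m + 1)) :
    (toeplitzMatrix m (X : R⟦X⟧) * A) a.succ c = A a.castSucc c := by
  rw [Matrix.mul_apply, Finset.sum_eq_single a.castSucc]
  · simp [toeplitzMatrix_apply]
  · intro e _ he
    rw [toeplitzMatrix_apply, coeff_X]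
    simp only [Ne, Fin.ext_iff, Fin.val_castSucc, Fin.val_succ] at he ⊢
    split_ifs
    · omega
    · exact zero_mul _
    · exact zero_mul _
  · exact fun h => absurd (Finset.mem_univ _) h

lemma mul_toeplitzMatrix_X_castSucc {m : ℕ} (A : Matrix (Fin (m + 1)) (Fin (m + 1)) R)
    (a : Fin m) (c : Fin (m + 1)) :
    (A * toeplitzMatrix m (X : R⟦X⟧)) c a.castSucc = A c a.succ := by
  rw [Matrix.mul_apply, Finset.sum_eq_single a.succ]
  · simp [toeplitzMatrix_apply]
  · intro e _ he
    rw [toeplitzMatrix_apply, coeff_X]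
    simp only [Ne, Fin.ext_iff, Fin.val_castSucc, Fin.val_succ] at he ⊢
    split_ifs
    · omega
    · exact mul_zero _
    · exact mul_zero _
  · exact fun h => absurd (Finset.mem_univ _) h

end Toeplitz

/-- If multiplication by any `s` in the maximal ideal eventually moves the ideals `(α i)` past all
of the later ones, then elements of the maximal ideal have proper divisors that are `e`-th
powers. -/
lemma IsDivergentSystem.exists_pow_dvd {R : Type u} [CommRing R] [IsLocalRing R]
    (hd : ∀ a b : R, a ∣ b ∨ b ∣ a) {ι : Type u} [LinearOrder ι] {z α : ι → R} {c : R}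
    (h : IsDivergentSystem z α c) (hα : ∀ s ∈ maximalIdeal R, ∃ i, ∀ k, α k ∣ s * α i)
    {p : R} (hp : p ∈ maximalIdeal R) (e : ℕ) : ∃ t ∈ maximalIdeal R, t ^ e ∣ p := by
  have hsq : ∀ p ∈ maximalIdeal R, ∃ t ∈ maximalIdeal R, t ^ 2 ∣ p := by
    intro p hp
    obtain ⟨i, hi⟩ := hα p hp
    obtain ⟨k, -, hk⟩ := h.exists_lt_not_dvd i
    obtain ⟨l, -, hl⟩ := h.exists_lt_not_dvd k
    obtain ⟨t, ht, hkt⟩ := exists_eq_mul_of_not_dvd hd hk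
    obtain ⟨t', ht', hlt⟩ := exists_eq_mul_of_not_dvd hd hl
    have h1 : α l = α i * (t * t') := by rw [hlt, hkt, mul_assoc]
    have h2 : t * t' ∣ p := by
      refine dvd_of_mul_dvd_mul_of_total hd (s := α i) (h1 ▸ h.ne_zero l) ?_
      rw [← h1, mul_comm (α i)]
      exact hi l
    rcases hd t t' with h3 | h3
    · exact ⟨t, ht, (sq t).dvd.trans ((mul_dvd_mul_left t h3).trans h2)⟩
    · exact ⟨t', ht', (sq t').dvd.trans ((mul_dvd_mul_right h3 t').trans h2)⟩
  have hpow : ∀ e : ℕ, ∃ t ∈ maximalIdeal R, t ^ 2 ^ e ∣ p := by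
    intro e
    induction e with
    | zero => exact ⟨p, hp, by simp⟩
    | succ e ih =>
      obtain ⟨t, ht, htp⟩ := ih
      obtain ⟨t', ht', htt⟩ := hsq t ht
      refine ⟨t', ht', ?_⟩
      rw [pow_succ', pow_mul]
      exact (pow_dvd_pow_of_dvd htt _).trans htp
  obtain ⟨t, ht, htp⟩ := hpow e
  exact ⟨t, ht, (pow_dvd_pow t e.lt_two_pow_self.le).trans htp⟩

/-- A divergent system along a well-order on which multiplication by every `s` in the maximal ideal
eventually moves the ideals `(α i)` past all of the later ones does not exist over a local ring of
bounded module type, if the shorter families of cosets have nonempty intersections; normalized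
form. -/
lemma IsDivergentSystem.false_of_dvd_mul_aux {R : Type u} [CommRing R] [IsLocalRing R] {n : ℕ}
    (hb : HasBoundedModuleType R n) {ι : Type u} [LinearOrder ι] [WellFoundedLT ι]
    (hι : ∀ i : ι, HasCosetIntersections R (Set.Iio i)) {z α : ι → R} {q : R}
    (h : IsDivergentSystem z α (q ^ (n + 1))) (hq : ∀ i, α i ∣ q)
    (hα : ∀ s ∈ maximalIdeal R, ∃ i, ∀ k, α k ∣ s * α i) {i₀ : ι} (hi₀ : ∀ i, i₀ ≤ i)
    (hP₀ : α i₀ ∈ maximalIdeal R) (hsq : ∀ k, α k ∣ α i₀ ^ 2) : False := by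
  have hd := hb.dvd_total
  set P := maximalIdeal R with hP
  set c := q ^ (n + 1) with hc
  have hαc : ∀ i, ∀ e ≤ n + 1, α i ^ e ∣ c := fun i e he =>
    (pow_dvd_pow_of_dvd (hq i) e).trans (pow_dvd_pow q he)
  have hα0 : ∀ i, ∀ e ≤ n + 1, α i ^ e ≠ 0 := fun i e he h0 =>
    h.bound_ne_zero (zero_dvd_iff.1 (h0 ▸ hαc i e he))
  have hαP : ∀ i, α i ∈ P := fun i => P.mem_of_dvd (h.dvd_of_le (hi₀ i)) hP₀
  obtain ⟨S, hS0, hS1, hSd, hSg⟩ := h.exists_units_normalized hι (m := n)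
    (fun i => hαc i _ le_rfl) hi₀
  let T : ι → Matrix (Fin (n + 1)) (Fin (n + 1)) R := fun i => toeplitzMatrix n (S i).val
  let T' : ι → Matrix (Fin (n + 1)) (Fin (n + 1)) R := fun i => toeplitzMatrix n (S i)⁻¹.val
  have hTT' : ∀ i, T i * T' i = 1 := fun i => by
    rw [← toeplitzMatrix_mul, Units.mul_inv, toeplitzMatrix_one]
  have hT'T : ∀ i, T' i * T i = 1 := fun i => by
    rw [← toeplitzMatrix_mul, Units.inv_mul, toeplitzMatrix_one]
  have hTG : ∀ i k, T k = toeplitzMatrix n ((S i)⁻¹ * S k : (PowerSeries R)ˣ).val * T i := by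
    intro i k
    rw [← toeplitzMatrix_mul, ← Units.val_mul, mul_right_comm, inv_mul_cancel, one_mul]
  let Q : ι → (Fin (n + 1) → R) → Prop := fun i v =>
    ∀ b : Fin (n + 1), c ∣ α i ^ (n - b : ℕ) * (T i).mulVec v b
  have hQmono : ∀ {i k v}, i ≤ k → Q i v → Q k v := by
    intro i k v hik hv b
    rw [hTG i k, ← Matrix.mulVec_mulVec, Matrix.mulVec, dotProduct, Finset.mul_sum]
    refine Finset.dvd_sum fun e _ => ?_
    rw [← mul_assoc]
    rw [toeplitzMatrix_apply]
    split_ifs with heb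
    · refine (hv e).trans (mul_dvd_mul_right ?_ _)
      rw [show (n - e : ℕ) = (n - b : ℕ) + (b - e : ℕ) by omega, pow_add]
      exact mul_dvd_mul (pow_dvd_pow_of_dvd (h.dvd_of_le hik) _) (hSg i k hik _ (by omega))
    · rw [mul_zero, zero_mul]
      exact dvd_zero _
  let K : Submodule R (Fin (n + 1) → R) :=
    { carrier := {v | ∃ i, Q i v}
      zero_mem' := ⟨i₀, fun b => by simp⟩
      add_mem' := by
        rintro v w ⟨i, hi⟩ ⟨k, hk⟩
        refine ⟨max i k, fun b => ?_⟩
        rw [Matrix.mulVec_add, Pi.add_apply, mul_add]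
        exact dvd_add (hQmono (le_max_left i k) hi b) (hQmono (le_max_right i k) hk b)
      smul_mem' := by
        rintro r v ⟨i, hi⟩
        refine ⟨i, fun b => ?_⟩
        rw [Matrix.mulVec_smul, Pi.smul_apply, smul_eq_mul, mul_left_comm]
        exact (hi b).mul_left r }
  have hK : ∀ v ∈ K, ∀ j, v j ∈ P := by
    rintro v ⟨i, hi⟩ j
    have h1 : ∀ b, (T i).mulVec v b ∈ P := by
      refine fun b => (mem_maximalIdeal _).2 fun hu => ?_
      have h2 : c ∣ α i ^ (n + 1) := (hu.dvd_mul_right.1 (hi b)).trans (pow_dvd_pow _ (by omega))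
      obtain ⟨k, -, hk⟩ := h.exists_lt_not_dvd i
      obtain ⟨t, ht, hkt⟩ := exists_eq_mul_of_not_dvd hd hk
      have h3 : α i ^ (n + 1) * t ^ (n + 1) ∣ α i ^ (n + 1) * 1 := by
        rw [← mul_pow, ← hkt, mul_one]
        exact (hαc k _ le_rfl).trans h2
      have h4 : t ^ (n + 1) ∣ 1 := dvd_of_mul_dvd_mul_of_total hd
        (by rw [← mul_pow, ← hkt]; exact hα0 k _ le_rfl) h3
      exact (mem_maximalIdeal _).1 ht
        (isUnit_of_dvd_one ((dvd_pow_self t n.succ_ne_zero).trans h4))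
    have h2 : v = (T' i).mulVec ((T i).mulVec v) := by
      rw [Matrix.mulVec_mulVec, hT'T, Matrix.one_mulVec]
    rw [h2, Matrix.mulVec, dotProduct]
    exact P.sum_mem fun e _ => P.mul_mem_left _ (h1 e)
  refine absurd (hb.card_le K hK Fin.rev fun Φ hΦ => ?_) (by omega)
  let Ω : ι → ι → Matrix (Fin (n + 1)) (Fin (n + 1)) R := fun i k => T k * Φ * T' i
  have hΩ : ∀ i (a : Fin (n + 1)), ∃ k, i ≤ k ∧ ∀ b : Fin (n + 1),
      α i ^ (n - a : ℕ) ∣ α k ^ (n - b : ℕ) * Ω i k b a := by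
    intro i a
    obtain ⟨r, hr⟩ := hαc i (n - a) (by omega)
    have hmem : (T' i).mulVec (r • Pi.single a 1) ∈ K := by
      refine ⟨i, fun b => ?_⟩
      rw [Matrix.mulVec_mulVec, hTT', Matrix.one_mulVec, Pi.smul_apply, smul_eq_mul]
      by_cases hab : b = a
      · rw [hab, Pi.single_eq_same, mul_one, ← hr]
      · rw [Pi.single_eq_of_ne hab, mul_zero, mul_zero]
        exact dvd_zero c
    obtain ⟨k, hk⟩ := hΦ _ hmem
    refine ⟨max i k, le_max_left i k, fun b => ?_⟩
    have h1 := hQmono (le_max_right i k) hk b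
    rw [Matrix.mulVec_mulVec, Matrix.mulVec_mulVec, Matrix.mulVec_smul,
      Matrix.mulVec_single_one, Pi.smul_apply, smul_eq_mul, mul_left_comm, hr, mul_comm _ r] at h1
    exact dvd_of_mul_dvd_mul_of_total hd (by rw [mul_comm, ← hr]; exact h.bound_ne_zero) h1
  have hΩdvd : ∀ j a, ∃ i k, j ≤ i ∧ j ≤ k ∧ ∀ b, a < b → α j ∣ Ω i k b a := by
    intro j a
    obtain ⟨j', hjj', hj'⟩ := h.exists_lt_not_dvd j
    obtain ⟨p, hp, hjp⟩ := exists_eq_mul_of_not_dvd hd hj'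
    obtain ⟨t, ht, htp⟩ := h.exists_pow_dvd hd hα hp n
    obtain ⟨i', hi'⟩ := hα t ht
    obtain ⟨k, hik, hk⟩ := hΩ (max i' j') a
    set i := max i' j' with hi
    have hji : j ≤ i := hjj'.le.trans (le_max_right _ _)
    refine ⟨i, k, hji, hji.trans hik, fun b hab => ?_⟩
    have hab' : (a : ℕ) < b := hab
    set e : ℕ := n - b with he
    have h1 : α i ^ (e + 1) ∣ α k ^ e * Ω i k b a := (pow_dvd_pow _ (by omega)).trans (hk b)
    have h2 : α k ^ e * α j ∣ α i ^ (e + 1) := by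
      have h3 : α k ∣ t * α i := (hi' k).trans (mul_dvd_mul_left t (h.dvd_of_le (le_max_left _ _)))
      have h4 : α k ^ e ∣ t ^ e * α i ^ e := mul_pow t (α i) e ▸ pow_dvd_pow_of_dvd h3 e
      have h5 : t ^ e ∣ p := (pow_dvd_pow t (by omega)).trans htp
      have h6 : α j * t ^ e ∣ α i :=
        ((mul_dvd_mul_left _ h5).trans hjp.symm.dvd).trans (h.dvd_of_le (le_max_right _ _))
      calc α k ^ e * α j ∣ (t ^ e * α i ^ e) * α j := mul_dvd_mul_right h4 _
        _ = α i ^ e * (α j * t ^ e) := by ring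
        _ ∣ α i ^ e * α i := mul_dvd_mul_left _ h6
        _ = α i ^ (e + 1) := (pow_succ _ _).symm
    refine dvd_of_mul_dvd_mul_of_total hd (fun h0 => ?_) (h2.trans h1)
    exact hα0 i (e + 1) (by omega) (zero_dvd_iff.1 (h0 ▸ h2))
  have hSinv0 : ∀ i, PowerSeries.constantCoeff (S i)⁻¹.val = 1 := fun i =>
    constantCoeff_units_inv (hS0 i)
  have hSinvd : ∀ i, ∀ d ≤ n + 1, α i₀ ^ d ∣ PowerSeries.coeff d (S i)⁻¹.val := fun i =>
    pow_dvd_coeff_units_inv (hS0 i) (hSd i)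
  have hSinv1 : ∀ i, PowerSeries.coeff 1 (S i)⁻¹.val = -(z i - z i₀) := fun i => by
    have h1 := coeff_one_mul_of_constantCoeff (hS0 i) (hSinv0 i)
    rw [Units.mul_inv, PowerSeries.coeff_one, if_neg one_ne_zero, hS1] at h1
    exact eq_neg_of_add_eq_zero_right h1.symm
  have hmodP : ∀ i k b a, Ω i k b a - Φ b a ∈ P := by
    intro i k b a
    have h1 : ∀ U : PowerSeries R, PowerSeries.constantCoeff U = 1 →
        (∀ d ≤ n + 1, α i₀ ^ d ∣ PowerSeries.coeff d U) →
        (toeplitzMatrix n U).map (Ideal.Quotient.mk P) = 1 := by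
      intro U hU0 hUd
      have hUP : ∀ d ≤ n + 1, 1 ≤ d → PowerSeries.coeff d U ∈ P := fun d hd hd1 =>
        P.mem_of_dvd (hUd d hd) (P.pow_mem_of_mem hP₀ d hd1)
      rw [toeplitzMatrix_map_mk n P hU0 fun d hd hd2 => hUP d (by omega) (by omega),
        Ideal.Quotient.eq_zero_iff_mem.2 (hUP 1 (by omega) le_rfl), zero_smul, add_zero]
    have h2 : (Ω i k).map (Ideal.Quotient.mk P) = Φ.map (Ideal.Quotient.mk P) := by
      rw [Matrix.map_mul, Matrix.map_mul, h1 _ (hS0 k) (hSd k), h1 _ (hSinv0 i) (hSinvd i),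
        one_mul, mul_one]
    exact Ideal.Quotient.eq.1 (congrFun (congrFun h2 b) a)
  have hmodα : ∀ j i k (a : Fin n), α j ∣ Ω i k a.succ a.castSucc - (Φ a.succ a.castSucc +
      (z k - z i₀) * Φ a.castSucc a.castSucc - (z i - z i₀) * Φ a.succ a.succ) := by
    intro j i k a
    set J := Ideal.span {α j} with hJ
    have h1 : ∀ U : PowerSeries R, (∀ d ≤ n + 1, α i₀ ^ d ∣ PowerSeries.coeff d U) →
        ∀ d ≤ n, 2 ≤ d → PowerSeries.coeff d U ∈ J := fun U hU d hd hd2 =>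
      Ideal.mem_span_singleton.2 ((hsq j).trans ((pow_dvd_pow _ hd2).trans (hU d (by omega))))
    have hxy : Ideal.Quotient.mk J (z k - z i₀) * Ideal.Quotient.mk J (-(z i - z i₀)) = 0 := by
      rw [← map_mul, Ideal.Quotient.eq_zero_iff_mem, Ideal.mem_span_singleton, mul_neg, dvd_neg]
      refine (hsq j).trans ?_
      rw [sq]
      exact mul_dvd_mul (h.dvd_sub_of_le (hi₀ k)) (h.dvd_sub_of_le (hi₀ i))
    have h2 : (Ω i k).map (Ideal.Quotient.mk J) = Φ.map (Ideal.Quotient.mk J) +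
        Ideal.Quotient.mk J (z k - z i₀) •
          (toeplitzMatrix n PowerSeries.X * Φ.map (Ideal.Quotient.mk J)) +
        Ideal.Quotient.mk J (-(z i - z i₀)) •
          (Φ.map (Ideal.Quotient.mk J) * toeplitzMatrix n PowerSeries.X) := by
      rw [Matrix.map_mul, Matrix.map_mul, toeplitzMatrix_map_mk n J (hS0 k) (h1 _ (hSd k)),
        toeplitzMatrix_map_mk n J (hSinv0 i) (h1 _ (hSinvd i)), hS1, hSinv1]
      simp only [add_mul, mul_add, one_mul, mul_one, smul_mul_assoc, mul_smul_comm, smul_add]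
      rw [smul_smul (Ideal.Quotient.mk J (-(z i - z i₀))),
        mul_comm (Ideal.Quotient.mk J (-(z i - z i₀))), hxy, zero_smul, add_zero]
    have h3 := congrFun (congrFun h2 a.succ) a.castSucc
    rw [Matrix.add_apply, Matrix.add_apply, Matrix.smul_apply, Matrix.smul_apply,
      toeplitzMatrix_X_mul_succ_castSucc, mul_toeplitzMatrix_X_castSucc] at h3
    simp only [Matrix.map_apply, smul_eq_mul, ← map_mul, ← map_add] at h3
    convert Ideal.mem_span_singleton.1 (Ideal.Quotient.eq.1 h3) using 1
    ring
  have hlow : ∀ a b : Fin (n + 1), a < b → Φ b a ∈ P := by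
    intro a b hab
    obtain ⟨i, k, -, -, hik⟩ := hΩdvd i₀ a
    rw [← sub_sub_cancel (Ω i k b a) (Φ b a)]
    exact P.sub_mem (P.mem_of_dvd (hik b hab) (hαP i₀)) (hmodP i k b a)
  have hstep : ∀ a : Fin n, Φ a.succ a.succ - Φ a.castSucc a.castSucc ∈ P := by
    intro a
    refine (mem_maximalIdeal _).2 fun hu => ?_
    obtain ⟨ε, hε⟩ := hu
    refine h.no_limit (z i₀ + (ε⁻¹ : Rˣ).val * Φ a.succ a.castSucc) fun j => ?_
    obtain ⟨i, k, hji, hjk, hik⟩ := hΩdvd j a.castSucc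
    have h1 := dvd_sub (hik a.succ Fin.castSucc_lt_succ) (hmodα j i k a)
    have h2 := (h.dvd_sub_of_le hji).mul_right (Φ a.succ a.succ)
    have h3 := (h.dvd_sub_of_le hjk).mul_right (Φ a.castSucc a.castSucc)
    convert (dvd_sub (dvd_add h1 h2) h3).mul_left (ε⁻¹ : Rˣ).val using 1
    have h4 : (ε⁻¹ : Rˣ).val * ε = 1 := ε.inv_mul
    linear_combination (z i₀ - z j) * (ε⁻¹ : Rˣ).val * hε - (z i₀ - z j) * h4
  have hdiag : ∀ a : Fin (n + 1), Φ a a - Φ 0 0 ∈ P := by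
    intro a
    induction a using Fin.induction with
    | zero => simp
    | succ a ih => simpa using P.add_mem (hstep a) ih
  exact ⟨fun j l => sub_sub_sub_cancel_right (Φ j.rev j.rev) (Φ l.rev l.rev) (Φ 0 0) ▸
    P.sub_mem (hdiag j.rev) (hdiag l.rev), fun j l hjl => hlow _ _ (Fin.rev_lt_rev.2 hjl)⟩

/-- There are no divergent systems along a well-order over a local ring of bounded module type, if
the shorter families of cosets have nonempty intersections. -/
lemma IsDivergentSystem.false_of_wellFoundedLT {R : Type u} [CommRing R] [IsLocalRing R] {n : ℕ}
    (hb : HasBoundedModuleType R n) {ι : Type u} [LinearOrder ι] [WellFoundedLT ι]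
    (hι : ∀ i : ι, HasCosetIntersections R (Set.Iio i)) {z α : ι → R} {c : R}
    (h : IsDivergentSystem z α c) : False := by
  have hd := hb.dvd_total
  by_cases hs : ∃ s ∈ maximalIdeal R, ∀ i, ∃ k, s * α i ∣ α k
  · obtain ⟨s, hsP, hs⟩ := hs
    exact h.false_of_mul_dvd hb hsP hs
  have hα : ∀ s ∈ maximalIdeal R, ∃ i, ∀ k, α k ∣ s * α i := by
    push Not at hs
    intro s hsP
    obtain ⟨i, hi⟩ := hs s hsP
    exact ⟨i, fun k => (hd _ _).resolve_left (hi k)⟩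
  obtain ⟨q, hqP, hqc⟩ := h.exists_pow_dvd hd hα h.mem_maximalIdeal_bound (n + 1)
  have hq0 : q ^ (n + 1) ≠ 0 := fun h0 => h.bound_ne_zero (zero_dvd_iff.1 (h0 ▸ hqc))
  obtain ⟨i₁, hi₁⟩ := hα q hqP
  obtain ⟨w, β, d, hβ, hαβ⟩ := h.rescale hd i₁
  have hβ0 : ∀ i, α i₁ * β i ≠ 0 := fun i => hαβ i ▸ h.ne_zero _
  have hβq : ∀ i, β i ∣ q := fun i => by
    refine dvd_of_mul_dvd_mul_of_total hd (hβ0 i) ?_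
    rw [← hαβ, mul_comm (α i₁)]
    exact hi₁ _
  have hβα : ∀ s ∈ maximalIdeal R, ∃ i, ∀ k, β k ∣ s * β i := by
    intro s hsP
    obtain ⟨i, hi⟩ := hα s hsP
    refine ⟨i, fun k => dvd_of_mul_dvd_mul_of_total hd (hβ0 k) ?_⟩
    rw [← hαβ, mul_left_comm, ← hαβ]
    exact (hi _).trans (mul_dvd_mul_left s (h.dvd_of_le (le_max_right _ _)))
  obtain ⟨l⟩ := hβ.nonempty
  obtain ⟨i', -, hi'⟩ := hβ.exists_lt_not_dvd l
  have hi'P : β i' ∈ maximalIdeal R := (mem_maximalIdeal _).2 fun hu => hi' hu.dvd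
  obtain ⟨i'', hi''⟩ := hβα _ hi'P
  set j := max i' i'' with hj
  have hbot : ∀ i : ι, wellFounded_lt.min Set.univ ⟨l, Set.mem_univ l⟩ ≤ i := fun i =>
    not_lt.1 (wellFounded_lt.not_lt_min _ (Set.mem_univ i))
  have hβc : ∀ i, β i ∣ q ^ (n + 1) := fun i => (hβq i).trans (dvd_pow_self q n.succ_ne_zero)
  have hβ' := (hβ.of_bound hβc hq0).restrict j 0
  refine hβ'.false_of_dvd_mul_aux hb hι (fun i => hβq _) (fun s hsP => ?_) hbot ?_ fun k => ?_
  · obtain ⟨i, hi⟩ := hβα s hsP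
    exact ⟨i, fun k => (hi _).trans (mul_dvd_mul_left s (hβ.dvd_of_le (le_max_right _ _)))⟩
  · rw [max_eq_left (hbot j)]
    exact Ideal.mem_of_dvd _ (hβ.dvd_of_le (le_max_left _ _)) hi'P
  · rw [max_eq_left (hbot j), sq]
    exact (hi'' _).trans (mul_dvd_mul (hβ.dvd_of_le (le_max_left _ _))
      (hβ.dvd_of_le (le_max_right _ _)))

namespace HasCosetIntersections

lemma of_equiv {R ι ι' : Type u} [CommRing R] (e : ι' ≃ ι) (h : HasCosetIntersections R ι') :
    HasCosetIntersections R ι := by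
  classical
  rintro a A ⟨c, hc, hcA⟩ hfin
  obtain ⟨x, hx⟩ := h (a ∘ e) (A ∘ e) ⟨c, hc, fun i => hcA _⟩ fun s => by
    obtain ⟨x, hx⟩ := hfin (s.map e.toEmbedding)
    exact ⟨x, fun i hi => hx _ (Finset.mem_map_of_mem _ hi)⟩
  exact ⟨x, fun i => by simpa using hx (e.symm i)⟩

/-- If there are no divergent systems, then the families of cosets along a well-order without
maximum have nonempty intersections as soon as the shorter ones do. -/
lemma of_forall_Iio {R ι : Type u} [CommRing R] (hd : ∀ a b : R, a ∣ b ∨ b ∣ a)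
    [LinearOrder ι] [WellFoundedLT ι] [NoMaxOrder ι]
    (hι : ∀ i : ι, HasCosetIntersections R (Set.Iio i))
    (hno : ∀ (z α : ι → R) (c : R), ¬IsDivergentSystem z α c) : HasCosetIntersections R ι := by
  classical
  rintro a A ⟨c, hc, hcA⟩ hfin
  by_contra! hlim
  obtain ⟨l, -⟩ := hlim 0
  have : Nonempty ι := ⟨l⟩
  have hx : ∀ k : ι, ∃ x, ∀ i < k, x - a i ∈ A i := by
    intro k
    obtain ⟨x, hx⟩ := hι k (fun i => a i) (fun i => A i) ⟨c, hc, fun i => hcA i⟩ fun s => by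
      obtain ⟨x, hx⟩ := hfin (s.map (Function.Embedding.subtype _))
      exact ⟨x, fun i hi => hx _ (Finset.mem_map_of_mem _ hi)⟩
    exact ⟨x, fun i hi => hx ⟨i, hi⟩⟩
  choose x hx using hx
  let B : ι → Ideal R := fun k => ⨅ i : Set.Iio k, A i
  have hmemB : ∀ {k y}, y ∈ B k ↔ ∀ i < k, y ∈ A i := by
    intro k y
    simp only [B, Submodule.mem_iInf, Subtype.forall, Set.mem_Iio]
  have hB : Antitone B := fun i k hik y hy => hmemB.2 fun j hj => hmemB.1 hy j (hj.trans_le hik)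
  have hxB : ∀ {i k}, i ≤ k → x k - x i ∈ B i := fun {i k} hik => hmemB.2 fun j hj => by
    rw [← sub_sub_sub_cancel_right _ _ (a j)]
    exact (A j).sub_mem (hx k j (hj.trans_le hik)) (hx i j hj)
  have hlimB : ∀ v, ¬∀ i, v - x i ∈ B i := by
    intro v hv
    obtain ⟨i, hi⟩ := hlim v
    obtain ⟨k, hik⟩ := exists_gt i
    refine hi ?_
    rw [← sub_add_sub_cancel v (x k)]
    exact (A i).add_mem (hmemB.1 (hv k) i hik) (hx k i hik)
  have hlt : ∀ i, ∃ k, B k < B i := by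
    by_contra! hi
    obtain ⟨i, hi⟩ := hi
    refine hlimB (x i) fun k => ?_
    rcases le_total k i with hki | hik
    · exact hxB hki
    · have h1 : B i ≤ B k := by
        by_contra h2
        exact hi k (lt_of_le_not_ge (hB hik) h2)
      rw [← neg_sub]
      exact (B k).neg_mem (h1 (hxB hik))
  have hσ : ∀ I ∈ Set.range B, ∃ k, B k < I ∧ ∀ j, B j < I → k ≤ j := by
    rintro _ ⟨i, rfl⟩
    exact ⟨wellFounded_lt.min {k | B k < B i} (hlt i), wellFounded_lt.min_mem {k | B k < B i} _,
      fun j hj => not_lt.1 (wellFounded_lt.not_lt_min {k | B k < B i} hj)⟩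
  choose! σ hσB hσ using hσ
  have hβ : ∀ I ∈ Set.range B, ∃ b ∈ I, b ∉ B (σ I) := fun I hI =>
    SetLike.exists_of_lt (hσB I hI)
  choose! β hβ hβσ using hβ
  have hdvd : ∀ i y, y ∈ B (σ (B i)) → β (B i) ∣ y := fun i y hy =>
    (hd _ _).resolve_right fun h1 => hβσ _ ⟨i, rfl⟩ (Ideal.mem_of_dvd _ h1 hy)
  refine hno (fun i => x (σ (B i))) (fun i => β (B i)) c
    ⟨fun {i k} hik => ?_, fun {i k} hik => ?_, fun v hv => hlimB v fun i => ?_, fun i => ?_, hc⟩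
  · rcases (hB hik).eq_or_lt with h1 | h1
    · rw [h1]
    · exact hdvd i _ (hB (hσ _ ⟨i, rfl⟩ k h1) (hβ _ ⟨k, rfl⟩))
  · rcases (hB hik).eq_or_lt with h1 | h1
    · simp only [h1, sub_self, dvd_zero]
    · exact hdvd i _ (hxB (hσ _ ⟨i, rfl⟩ _ ((hσB _ ⟨k, rfl⟩).trans h1)))
  · have h1 : i ≤ σ (B i) := (lt_of_not_ge fun h2 => (hσB _ ⟨i, rfl⟩).not_ge (hB h2)).le
    rw [← sub_add_sub_cancel v (x (σ (B i)))]
    exact (B i).add_mem (Ideal.mem_of_dvd _ (hv i) (hβ _ ⟨i, rfl⟩)) (hxB h1)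
  · exact hdvd i c (hmemB.2 fun j _ => hcA j)

end HasCosetIntersections

open Cardinal in
lemma HasBoundedModuleType.hasCosetIntersections {R : Type u} [CommRing R] [IsLocalRing R] {n : ℕ}
    (hb : HasBoundedModuleType R n) (ι : Type u) : HasCosetIntersections R ι := by
  induction hκ : #ι using WellFoundedLT.induction generalizing ι with
  | ind κ ih =>
    subst hκ
    rcases finite_or_infinite ι with hfin | hinf
    · have := Fintype.ofFinite ι
      intro a A _ h
      obtain ⟨x, hx⟩ := h Finset.univ
      exact ⟨x, fun i => hx i (Finset.mem_univ i)⟩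
    · have := Cardinal.noMaxOrder (aleph0_le_mk ι)
      obtain ⟨e⟩ := Cardinal.eq.1 (mk_ord_toType #ι)
      have hι : ∀ i : (#ι).ord.ToType, HasCosetIntersections R (Set.Iio i) := fun i =>
        ih _ ((mk_Iio_lt i (by simp)).trans_eq (mk_ord_toType _)) _ rfl
      exact .of_equiv e (.of_forall_Iio hb.dvd_total hι fun _ _ _ h =>
        h.false_of_wellFoundedLT hb hι)

lemma isAlmostMaximalRing_of_hasCosetIntersections {R : Type u} [CommRing R]
    (h : ∀ ι : Type u, HasCosetIntersections R ι) : IsAlmostMaximalRing R := by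
  intro A hA ι a I hfin
  obtain ⟨c, hcA, hc⟩ := Submodule.exists_mem_ne_zero_of_ne_bot hA
  choose b hb using fun i => Ideal.Quotient.mk_surjective (a i)
  have hmem : ∀ y i, y - b i ∈ (I i).comap (Ideal.Quotient.mk A) ↔
      Ideal.Quotient.mk A y - a i ∈ I i := fun y i => by
    rw [Ideal.mem_comap, map_sub, hb]
  obtain ⟨x, hx⟩ := h ι b (fun i => (I i).comap (Ideal.Quotient.mk A)) ⟨c, hc, fun i => by
      rw [Ideal.mem_comap, Ideal.Quotient.eq_zero_iff_mem.2 hcA]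
      exact zero_mem _⟩ fun s => by
    obtain ⟨y, hy⟩ := hfin s
    obtain ⟨y, rfl⟩ := Ideal.Quotient.mk_surjective y
    exact ⟨y, fun i hi => (hmem y i).2 (hy i hi)⟩
  exact ⟨Ideal.Quotient.mk A x, fun i => (hmem x i).1 (hx i)⟩

/-- Vámos' conjecture. -/
theorem stmt12 (R : Type u) [CommRing R] [IsLocalRing R]
    (h : ∃ n : ℕ, 0 < n ∧ HasBoundedModuleType R n) :
    IsChainRing R ∧ IsAlmostMaximalRing R := by
  obtain ⟨n, -, hb⟩ := h
  exact ⟨isChainRing_of_dvd_total hb.dvd_total,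
    isAlmostMaximalRing_of_hasCosetIntersections hb.hasCosetIntersections⟩
end

section
/- Let R be an archimedean valuation domain with maximal immediate extension R̃, and let Q, Q̃ be the fields of fractions of R and R̃ respectively. If the field extension degree [Q̃ : Q] is finite, then R is almost maximal. -/
open IsLocalRing

universe u

open scoped NNReal

theorem IsChainRing.valuationRing {R : Type u} [CommRing R] [IsDomain R] (h : IsChainRing R) :
    ValuationRing R where
  toPreValuationRing := PreValuationRing.iff_ideal_total.mpr ⟨h⟩

theorem IsArchimedeanLocal.exists_dvd_pow {R : Type u} [CommRing R] [IsLocalRing R]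
    (h : IsArchimedeanLocal R) {b : R} (hb : b ∈ maximalIdeal R) {d : R} (hd : d ≠ 0) :
    ∃ n : ℕ, d ∣ b ^ n := by
  have hrad : b ∈ (Ideal.span {d}).radical := by
    rw [Ideal.radical_eq_sInf, Ideal.mem_sInf]
    rintro P ⟨hP, hPp⟩
    have hdP : d ∈ P := hP (Ideal.mem_span_singleton_self d)
    rw [h P hPp (fun h0 => hd (by simpa [h0] using hdP))]
    exact hb
  obtain ⟨n, hn⟩ := hrad
  exact ⟨n, Ideal.mem_span_singleton.mp hn⟩

theorem ValuationRing.valuation_le_one_iff {A K : Type u} [CommRing A] [IsDomain A]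
    [ValuationRing A] [Field K] [Algebra A K] [IsFractionRing A K] (x : K) :
    ValuationRing.valuation A K x ≤ 1 ↔ ∃ a : A, algebraMap A K a = x :=
  ValuationRing.mem_integer_iff A K x

theorem IsArchimedeanLocal.mulArchimedean_valueGroup {A : Type u} [CommRing A] [IsDomain A]
    [ValuationRing A] (h : IsArchimedeanLocal A)
    (K : Type u) [Field K] [Algebra A K] [IsFractionRing A K] :
    MulArchimedean (ValuationRing.ValueGroup A K) where
  arch x y hy := by
    obtain ⟨a, rfl⟩ : ∃ a, ValuationRing.valuation A K a = x := Quotient.mk''_surjective x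
    obtain ⟨b, rfl⟩ : ∃ b, ValuationRing.valuation A K b = y := Quotient.mk''_surjective y
    obtain ⟨β, hβ⟩ := (ValuationRing.valuation_le_one_iff (A := A) b⁻¹).mp (by
      rw [map_inv₀]; exact inv_le_one_of_one_le₀ hy.le)
    have hβm : β ∈ maximalIdeal A := by
      rw [mem_maximalIdeal, mem_nonunits_iff]
      rintro ⟨γ, rfl⟩
      refine hy.not_ge ((ValuationRing.valuation_le_one_iff b).mpr ⟨(γ⁻¹ : Aˣ), ?_⟩)
      rw [map_units_inv, hβ, inv_inv]
    obtain ⟨c, d, hd, rfl⟩ := IsFractionRing.div_surjective A a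
    obtain ⟨n, e, he⟩ := h.exists_dvd_pow hβm (nonZeroDivisors.ne_zero hd)
    refine ⟨n, ?_⟩
    rw [← map_pow, ← div_le_one₀ (by rw [map_pow]; exact pow_pos (zero_lt_one.trans hy) n),
      ← map_div₀, ValuationRing.valuation_le_one_iff]
    refine ⟨c * e, ?_⟩
    have hd' : algebraMap A K d ≠ 0 := IsFractionRing.to_map_ne_zero_of_mem_nonZeroDivisors hd
    have := congrArg (algebraMap A K) he
    rw [map_pow, hβ, map_mul] at this
    rw [map_mul, div_eq_mul_inv _ (b ^ n), ← inv_pow, this]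
    field_simp

theorem IsArchimedeanLocal.exists_nnreal_valuation {A : Type u} [CommRing A] [IsDomain A]
    [ValuationRing A] (h : IsArchimedeanLocal A)
    {b : A} (hb : b ∈ maximalIdeal A) (hb0 : b ≠ 0)
    (K : Type u) [Field K] [Algebra A K] [IsFractionRing A K] :
    ∃ w : Valuation K ℝ≥0, (∀ x, w x ≤ 1 ↔ ∃ a : A, algebraMap A K a = x) ∧ ∃ t, 1 < w t := by
  set v := ValuationRing.valuation A K
  have hb0' : algebraMap A K b ≠ 0 := by simpa using hb0
  have hbv : 1 < v (algebraMap A K b)⁻¹ := by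
    rw [← not_le, ValuationRing.valuation_le_one_iff]
    rintro ⟨c, hc⟩
    rw [← mul_eq_one_iff_eq_inv₀ hb0', ← map_mul,
      map_eq_one_iff _ (IsFractionRing.injective A K)] at hc
    exact hb (IsUnit.of_mul_eq_one_right _ hc)
  have := h.mulArchimedean_valueGroup K
  have : v.IsNontrivial := ⟨⟨_, (v.ne_zero_iff).mpr (inv_ne_zero hb0'), hbv.ne'⟩⟩
  have : MulArchimedean (MonoidWithZeroHom.ValueGroup₀ (.ofClass v)) :=
    MulArchimedean.comap MonoidWithZeroHom.ValueGroup₀.embedding.toMonoidHom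
      MonoidWithZeroHom.ValueGroup₀.embedding_strictMono
  obtain ⟨hr⟩ := (Valuation.nonempty_rankOne_iff_mulArchimedean (v := v)).mpr inferInstance
  have hle : ∀ x, v.restrict.map hr.hom' hr.strictMono'.monotone x ≤ 1 ↔
      ∃ a : A, algebraMap A K a = x := fun x => by
    rw [Valuation.map_apply, ← map_one hr.hom', hr.strictMono'.le_iff_le,
      Valuation.restrict_le_one_iff, ValuationRing.valuation_le_one_iff]
  refine ⟨v.restrict.map hr.hom' hr.strictMono'.monotone, hle, (algebraMap A K b)⁻¹, ?_⟩
  rw [← not_le, hle, ← ValuationRing.valuation_le_one_iff, not_le]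
  exact hbv

/-- Every sequence of nested closed balls has a common point. -/
def Valuation.IsSphericallyComplete {L : Type u} [Field L] (w : Valuation L ℝ≥0) : Prop :=
  ∀ (x : ℕ → L) (s : ℕ → ℝ≥0), Antitone s → (∀ n, w (x (n + 1) - x n) ≤ s n) →
    ∃ y, ∀ n, w (y - x n) ≤ s n

theorem Valuation.map_sub_le_of_le {L : Type u} [Field L] (w : Valuation L ℝ≥0) {x : ℕ → L}
    {s : ℕ → ℝ≥0} (hs : Antitone s) (hx : ∀ n, w (x (n + 1) - x n) ≤ s n) {m n : ℕ}
    (hmn : m ≤ n) : w (x n - x m) ≤ s m := by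
  induction n, hmn using Nat.le_induction with
  | base => simp
  | succ n hmn ih =>
    rw [← sub_add_sub_cancel (x (n + 1)) (x n) (x m)]
    exact w.map_add_le ((hx n).trans (hs hmn)) ih

theorem IsMaximalRing.isSphericallyComplete {A L : Type u} [CommRing A] (hA : IsMaximalRing A)
    [Field L] [Algebra A L] (w : Valuation L ℝ≥0)
    (hw : ∀ x, w x ≤ 1 ↔ ∃ a : A, algebraMap A L a = x) {t : L} (ht : 1 < w t) :
    w.IsSphericallyComplete := by
  intro x s hs hx
  obtain ⟨k, hk⟩ : ∃ k : ℕ, s 0 < w (t ^ k) := by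
    simpa only [map_pow] using pow_unbounded_of_one_lt (s 0) ht
  set τ := t ^ k
  have hτpos : 0 < w τ := (zero_le).trans_lt hk
  have hτ : τ ≠ 0 := w.pos_iff.mp hτpos
  have hxA : ∀ n, ∃ a : A, algebraMap A L a = (x n - x 0) / τ := fun n => by
    rw [← hw, map_div₀]
    exact div_le_one_of_le₀ ((w.map_sub_le_of_le hs hx n.zero_le).trans hk.le) zero_le
  choose a ha using hxA
  have hA1 : ∀ a : A, w (algebraMap A L a) ≤ 1 := fun a => (hw _).mpr ⟨a, rfl⟩
  let B : ULift.{u} ℕ → Ideal A := fun n =>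
    { carrier := {c | w (algebraMap A L c) ≤ s n.down / w τ}
      add_mem' := fun {c d} hc hd => by
        simpa only [Set.mem_ofPred_eq, map_add] using w.map_add_le hc hd
      zero_mem' := by simp
      smul_mem' := fun r c hc => by
        simpa only [Set.mem_ofPred_eq, smul_eq_mul, map_mul] using
          (mul_le_of_le_one_left zero_le (hA1 r)).trans hc }
  have hB : ∀ (n : ULift.{u} ℕ) (c : A), c ∈ B n ↔ w (algebraMap A L c) ≤ s n.down / w τ :=
    fun _ _ => Iff.rfl
  obtain ⟨y, hy⟩ := hA (ULift.{u} ℕ) (fun n => a n.down) B (fun S => by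
    refine ⟨a (S.sup ULift.down), fun i hi => ?_⟩
    rw [hB, map_sub, ha, ha, ← sub_div, sub_sub_sub_cancel_right, map_div₀]
    gcongr
    exact w.map_sub_le_of_le hs hx (Finset.le_sup hi))
  refine ⟨algebraMap A L y * τ + x 0, fun n => ?_⟩
  have := hy ⟨n⟩
  rw [hB, map_sub, ha, le_div_iff₀ hτpos, ← map_mul] at this
  convert this using 2
  field_simp
  ring

/-- Over a field extension of finite degree, a subspace of the valued field `L` that is maximal
among the nondense ones. -/
theorem Valuation.exists_maximal_nondense {K L : Type u} [Field K] [Field L] [Algebra K L]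
    [FiniteDimensional K L] (w : Valuation L ℝ≥0) :
    ∃ (H : Submodule K L) (z : L) (ε : ℝ≥0), 0 < ε ∧ (∀ h ∈ H, ε ≤ w (z - h)) ∧
      ∀ x, ∀ δ > 0, ∃ q : K, ∃ h ∈ H, w (x - q • z - h) < δ := by
  obtain ⟨H, ⟨z, ε, hε, hz⟩, hmax⟩ := set_has_maximal_iff_noetherian.mpr
    (inferInstance : IsNoetherian K L)
    {H | ∃ (z : L) (ε : ℝ≥0), 0 < ε ∧ ∀ h ∈ H, ε ≤ w (z - h)}
    ⟨⊥, 1, 1, one_pos, by simp⟩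
  refine ⟨H, z, ε, hε, hz, fun x δ hδ => ?_⟩
  by_contra! hcon
  have hlt : H < K ∙ z ⊔ H := by
    refine lt_of_le_of_ne le_sup_right fun heq => ?_
    have hzH : z ∈ H := heq ▸ Submodule.mem_sup_left (Submodule.mem_span_singleton_self z)
    exact hε.not_ge (by simpa using hz z hzH)
  refine hmax _ ⟨x, δ, hδ, fun y hy => ?_⟩ hlt
  obtain ⟨y', hy', h, hh, rfl⟩ := Submodule.mem_sup.mp hy
  obtain ⟨q, rfl⟩ := Submodule.mem_span_singleton.mp hy'
  simpa [sub_add_eq_sub_sub] using hcon q h hh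

/-- If a finite extension of a valued field is spherically complete, then nested sequences of
balls with radii bounded away from zero have a common point in the base field. -/
theorem Valuation.IsSphericallyComplete.exists_of_finiteDimensional {K L : Type u} [Field K]
    [Field L] [Algebra K L] [FiniteDimensional K L] {w : Valuation L ℝ≥0}
    (hw : w.IsSphericallyComplete) {α : ℕ → K} {u : ℕ → ℝ≥0} {r : ℝ≥0} (hr : 0 < r)
    (hru : ∀ n, r ≤ u n) (hu : Antitone u)
    (hα : ∀ n, w (algebraMap K L (α (n + 1) - α n)) < u n) :
    ∃ q : K, ∀ n, w (algebraMap K L (q - α n)) ≤ u n := by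
  obtain ⟨H, z, ε, hε, hz, hdense⟩ := w.exists_maximal_nondense (K := K)
  -- the distance from `z` to `H`
  set c : ℝ≥0 := ⨅ h : H, w (z - h)
  have hcle : ∀ h ∈ H, c ≤ w (z - h) := fun h hh => ciInf_le' (fun h : H => w (z - h)) ⟨h, hh⟩
  have hc : 0 < c := hε.trans_le (le_ciInf fun h => hz h h.2)
  have hlow : ∀ (q : K), ∀ h ∈ H, c * w (algebraMap K L q) ≤ w (q • z - h) := by
    intro q h hh
    rcases eq_or_ne q 0 with rfl | hq
    · simp
    · have hfac : q • z - h = (z - q⁻¹ • h) * algebraMap K L q := by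
        rw [mul_comm, ← Algebra.smul_def, smul_sub, smul_inv_smul₀ hq]
      rw [hfac, map_mul]
      gcongr
      exact hcle _ (H.smul_mem _ hh)
  have hup : ∀ (q : K) (s : ℝ≥0), w (algebraMap K L q) < s → ∃ h ∈ H, w (q • z - h) < c * s := by
    intro q s hs
    rcases eq_or_ne q 0 with rfl | hq
    · exact ⟨0, H.zero_mem, by simpa using mul_pos hc (zero_le.trans_lt hs)⟩
    · have hqpos : 0 < w (algebraMap K L q) := w.pos_iff.mpr (by simpa using hq)
      have : c < c * s / w (algebraMap K L q) := by
        rw [lt_div_iff₀ hqpos]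
        exact mul_lt_mul_of_pos_left hs hc
      obtain ⟨h, hh⟩ := exists_lt_of_ciInf_lt this
      refine ⟨q • h, H.smul_mem _ h.2, ?_⟩
      rw [← smul_sub, Algebra.smul_def, map_mul, mul_comm]
      exact (lt_div_iff₀ hqpos).mp hh
  choose g hgH hg using fun n => hup _ _ (hα n)
  -- lifts of the centres `α n • z` modulo `H`
  let x : ℕ → L := fun n => α n • z - ∑ i ∈ Finset.range n, g i
  have hx : ∀ n, x (n + 1) - x n = (α (n + 1) - α n) • z - g n := fun n => by
    simp only [x, Finset.sum_range_succ, sub_smul]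
    ring
  obtain ⟨y, hy⟩ := hw x (fun n => c * u n)
    (fun m n hmn => mul_le_mul_of_nonneg_left (hu hmn) zero_le) (fun n => by rw [hx]; exact (hg n).le)
  obtain ⟨q, h, hh, hq⟩ := hdense y (c * r) (mul_pos hc hr)
  refine ⟨q, fun n => le_of_mul_le_mul_left ?_ hc⟩
  have hsum : ∑ i ∈ Finset.range n, g i ∈ H := H.sum_mem fun i _ => hgH i
  refine (hlow _ _ (H.sub_mem (H.neg_mem hsum) hh)).trans ?_
  have hdecomp : (q - α n) • z - (-(∑ i ∈ Finset.range n, g i) - h) =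
      (y - x n) - (y - q • z - h) := by
    simp only [x, sub_smul]
    ring
  rw [hdecomp]
  refine w.map_sub_le (hy n) (hq.le.trans ?_)
  gcongr
  exact hru n

/-- A chain ring with a real-valued valuation compatible with divisibility satisfies the
linear compactness condition for families of ideals containing a common nonzero element as soon
as it does so for sequences of balls with radii bounded away from zero. -/
theorem IsChainRing.exists_forall_sub_mem {R : Type u} [CommRing R] (hR : IsChainRing R)
    (N : Valuation R ℝ≥0) (hN : ∀ a b : R, N a ≤ N b → b ∣ a)
    (hseq : ∀ (α : ℕ → R) (u : ℕ → ℝ≥0) (r : ℝ≥0), 0 < r → (∀ n, r ≤ u n) → Antitone u →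
      (∀ n, u n ∈ Set.range N) → (∀ n, N (α (n + 1) - α n) < u n) →
      ∃ q, ∀ n, N (q - α n) ≤ u n)
    {d : R} (hd : N d ≠ 0) {ι : Type u} (a : ι → R) (A : ι → Ideal R) (hdA : ∀ i, d ∈ A i)
    (hfip : ∀ s : Finset ι, ∃ x : R, ∀ i ∈ s, x - a i ∈ A i) :
    ∃ x : R, ∀ i, x - a i ∈ A i := by
  classical
  have hpair : ∀ i j, A i ≤ A j → a i - a j ∈ A j := fun i j hij => by
    obtain ⟨x, hx⟩ := hfip {i, j}
    rw [← sub_sub_sub_cancel_left (c := x)]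
    exact (A j).sub_mem (hx j (by simp)) (hij (hx i (by simp)))
  by_cases hmin : ∃ i, ∀ j, A i ≤ A j
  · obtain ⟨i, hi⟩ := hmin
    exact ⟨a i, fun j => hpair i j (hi j)⟩
  push Not at hmin
  rcases isEmpty_or_nonempty ι with hι | ⟨⟨i₀⟩⟩
  · exact ⟨0, fun i => hι.elim i⟩
  have hlt : ∀ {i b b'}, b ∈ A i → b' ∉ A i → N b < N b' := fun hb hb' => by
    by_contra! hle
    exact hb' ((A _).mem_of_dvd (hN _ _ hle) hb)
  have hdrop : ∀ i, ∃ b ∈ A i, ∃ j, b ∉ A j := fun i => by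
    obtain ⟨j, hj⟩ := hmin i
    obtain ⟨b, hb, hbj⟩ := SetLike.not_le_iff_exists.mp hj
    exact ⟨b, hb, j, hbj⟩
  let S : Set ℝ≥0 := {t | ∃ b, N b = t ∧ ∃ i, b ∉ A i}
  have hSne : S.Nonempty := by
    obtain ⟨b, -, j, hj⟩ := hdrop i₀
    exact ⟨_, b, rfl, j, hj⟩
  have hglb : IsGLB S (sInf S) := isGLB_csInf hSne (OrderBot.bddBelow S)
  have hnot : sInf S ∉ S := by
    rintro ⟨b, hb, i, hi⟩
    obtain ⟨b', hb', j, hj⟩ := hdrop i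
    exact (hglb.1 ⟨b', rfl, j, hj⟩).not_gt (hb ▸ hlt hb' hi)
  have hr : 0 < sInf S := by
    refine (pos_iff_ne_zero.mpr hd).trans_le (le_csInf hSne ?_)
    rintro _ ⟨b, rfl, i, hi⟩
    exact (hlt (hdA i) hi).le
  obtain ⟨u, hanti, hru, hlim, huS⟩ := hglb.exists_seq_strictAnti_tendsto_of_notMem hnot hSne
  choose b hbu i hbi using huS
  have hcmp : ∀ m n, N (a (i m) - a (i n)) < max (u m) (u n) := fun m n => by
    rcases hR (A (i m)) (A (i n)) with h | h
    · exact lt_max_of_lt_right (hbu n ▸ hlt (hpair _ _ h) (hbi n))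
    · rw [Valuation.map_sub_swap]
      exact lt_max_of_lt_left (hbu m ▸ hlt (hpair _ _ h) (hbi m))
  obtain ⟨q, hq⟩ := hseq (fun n => a (i n)) u (sInf S) hr (fun n => (hru n).le) hanti.antitone
    (fun n => ⟨b n, hbu n⟩)
    (fun n => (hcmp _ _).trans_le (max_le (hanti.antitone n.le_succ) le_rfl))
  refine ⟨q, fun j => ?_⟩
  obtain ⟨e, he, k, hek⟩ := hdrop j
  have hlte : sInf S < N e :=
    lt_of_le_of_ne (hglb.1 ⟨e, rfl, k, hek⟩) fun h => hnot (h ▸ ⟨e, rfl, k, hek⟩)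
  obtain ⟨n, hn⟩ := (hlim.eventually_lt_const hlte).exists
  have hbj : b n ∈ A j := (A j).mem_of_dvd (hN _ _ ((hbu n).trans_lt hn).le) he
  have hle : A (i n) ≤ A j := (hR _ _).resolve_right fun h => hbi n (h hbj)
  rw [← sub_add_sub_cancel q (a (i n)) (a j)]
  exact (A j).add_mem ((A j).mem_of_dvd (hN _ _ ((hq n).trans hn.le)) he) (hpair _ _ hle)

theorem stmt13 (R : Type u) [CommRing R] [IsDomain R] [IsLocalRing R]
    (hchain : IsChainRing R) (harch : IsArchimedeanLocal R)
    (Rt : Type u) [CommRing Rt] [IsDomain Rt] [IsLocalRing Rt]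
    (hchainT : IsChainRing Rt)
    [Algebra R Rt] (hinj : Function.Injective (algebraMap R Rt))
    (hdom : ∀ r : R, r ∈ maximalIdeal R ↔ algebraMap R Rt r ∈ maximalIdeal Rt)
    -- `Rt` is a maximal valuation ring:
    (hmax : IsMaximalRing Rt)
    -- the extension is immediate (same value group and residue field):
    (himm : ∀ x : Rt, x ≠ 0 →
      ∃ r : R, ∃ m ∈ maximalIdeal Rt, x - algebraMap R Rt r = x * m)
    (Q Qt : Type u) [Field Q] [Field Qt] [Algebra R Q] [IsFractionRing R Q]
    [Algebra Rt Qt] [IsFractionRing Rt Qt] [Algebra Q Qt] [Algebra R Qt]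
    [IsScalarTower R Q Qt] [IsScalarTower R Rt Qt]
    (hfin : FiniteDimensional Q Qt) :
    IsAlmostMaximalRing R := by
  intro A hA ι a B hfip
  have := hchain.valuationRing
  have := hchainT.valuationRing
  -- elements of `Rt` are associated to elements of `R`
  have hassoc : ∀ x : Rt, x ≠ 0 → ∃ r : R, Associated x (algebraMap R Rt r) := fun x hx => by
    obtain ⟨r, m, hm, hr⟩ := himm x hx
    obtain ⟨v, hv⟩ : IsUnit (1 - m) := by
      by_contra hn
      exact (mem_maximalIdeal _).mp ((Ideal.add_mem _ ((mem_maximalIdeal _).mpr hn) hm))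
        (by simp)
    exact ⟨r, v, by rw [hv]; linear_combination hr⟩
  have harchT : IsArchimedeanLocal Rt := fun P hP hP0 => by
    obtain ⟨x, hxP, hx0⟩ := Submodule.exists_mem_ne_zero_of_ne_bot hP0
    obtain ⟨r, hr⟩ := hassoc x hx0
    have hcomap : P.comap (algebraMap R Rt) = maximalIdeal R := by
      refine harch _ (hP.comap _) fun h0 => ?_
      have hrP : r ∈ P.comap (algebraMap R Rt) := P.mem_of_dvd hr.dvd hxP
      rw [h0, Ideal.mem_bot] at hrP
      rw [hrP, map_zero, associated_zero_iff_eq_zero] at hr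
      exact hx0 hr
    refine le_antisymm (le_maximalIdeal hP.ne_top) fun y hy => ?_
    rcases eq_or_ne y 0 with rfl | hy0
    · exact P.zero_mem
    obtain ⟨t, ht⟩ := hassoc y hy0
    have htm : t ∈ P.comap (algebraMap R Rt) := by
      rw [hcomap, hdom]
      exact Ideal.mem_of_dvd _ ht.dvd hy
    exact P.mem_of_dvd ht.symm.dvd htm
  obtain ⟨d, hdA, hd0⟩ := Submodule.exists_mem_ne_zero_of_ne_bot hA
  by_cases hdm : d ∈ maximalIdeal R
  swap
  · have hAtop : A = ⊤ := A.eq_top_of_isUnit_mem hdA (by simpa using hdm)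
    have : Subsingleton (R ⧸ A) := Ideal.Quotient.subsingleton_iff.mpr hAtop
    exact ⟨0, fun i => by rw [Subsingleton.elim (0 - a i) 0]; exact (B i).zero_mem⟩
  obtain ⟨w, hw, t, ht⟩ := harchT.exists_nnreal_valuation ((hdom d).mp hdm)
    (by simpa using (map_ne_zero_iff _ hinj).mpr hd0) Qt
  have hsph := hmax.isSphericallyComplete w hw ht
  have htower : ∀ r : R, algebraMap Q Qt (algebraMap R Q r) =
      algebraMap Rt Qt (algebraMap R Rt r) := fun r => by
    rw [← IsScalarTower.algebraMap_apply, ← IsScalarTower.algebraMap_apply]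
  -- `R` is the valuation ring of the restriction of `w` to `Q`
  have hQ : ∀ q : Q, w (algebraMap Q Qt q) ≤ 1 → ∃ r, algebraMap R Q r = q := by
    intro q hq
    rcases ValuationRing.isInteger_or_isInteger R q with ⟨r, hr⟩ | ⟨r, hr⟩
    · exact ⟨r, hr⟩
    rcases eq_or_ne q 0 with rfl | hq0
    · exact ⟨0, map_zero _⟩
    obtain ⟨c, hc⟩ := (hw _).mp hq
    have hunit : IsUnit (algebraMap R Rt r) := by
      refine IsUnit.of_mul_eq_one c (IsFractionRing.injective Rt Qt ?_)
      rw [map_mul, ← htower, hr, hc, ← map_mul, inv_mul_cancel₀ hq0, map_one, map_one]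
    have hr' : IsUnit r := by
      by_contra hn
      exact (mem_maximalIdeal _).mp ((hdom r).mp ((mem_maximalIdeal _).mpr hn)) hunit
    obtain ⟨v, rfl⟩ := hr'
    exact ⟨(v⁻¹ : Rˣ), by rw [map_units_inv, hr, inv_inv]⟩
  let N : Valuation R ℝ≥0 := w.comap ((algebraMap Q Qt).comp (algebraMap R Q))
  have hNdef : ∀ r, N r = w (algebraMap Q Qt (algebraMap R Q r)) := fun _ => rfl
  have hN1 : ∀ r, N r ≤ 1 := fun r => by rw [hNdef, htower]; exact (hw _).mpr ⟨_, rfl⟩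
  have hN0 : ∀ r, N r = 0 → r = 0 := fun r hr => by
    rw [hNdef] at hr
    simpa using hr
  have hN : ∀ a b : R, N a ≤ N b → b ∣ a := fun a b hab => by
    rcases eq_or_ne b 0 with rfl | hb
    · rw [hN0 a (by simpa using hab)]
    have hb' : algebraMap R Q b ≠ 0 := by simpa using hb
    obtain ⟨c, hc⟩ := hQ (algebraMap R Q a / algebraMap R Q b) (by
      rw [map_div₀, map_div₀]
      exact div_le_one_of_le₀ hab zero_le)
    refine ⟨c, IsFractionRing.injective R Q ?_⟩
    rw [map_mul, hc, mul_div_cancel₀ _ hb']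
  choose a' ha' using fun i => Ideal.Quotient.mk_surjective (a i)
  suffices h : ∃ x : R, ∀ i, x - a' i ∈ (B i).comap (Ideal.Quotient.mk A) by
    obtain ⟨x, hx⟩ := h
    exact ⟨Ideal.Quotient.mk A x, fun i => by simpa [ha'] using hx i⟩
  refine hchain.exists_forall_sub_mem N hN ?_ (fun h => hd0 (hN0 d h)) a' _ (fun i => ?_)
    fun s => ?_
  · intro α u r hr hru hu huN hα
    obtain ⟨q, hq⟩ := hsph.exists_of_finiteDimensional (α := fun n => algebraMap R Q (α n)) hr hru
      hu (fun n => by simpa only [hNdef, map_sub] using hα n)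
    obtain ⟨b, hb⟩ := huN 0
    obtain ⟨s, hs⟩ := hQ _ ((hq 0).trans (hb ▸ hN1 b))
    have hqs : algebraMap R Q (s + α 0) = q := by rw [map_add, hs, sub_add_cancel]
    exact ⟨s + α 0, fun n => by simpa only [hNdef, map_sub, hqs] using hq n⟩
  · simp [Ideal.Quotient.eq_zero_iff_mem.mpr hdA]
  · obtain ⟨x, hx⟩ := hfip s
    obtain ⟨x, rfl⟩ := Ideal.Quotient.mk_surjective x
    exact ⟨x, fun i hi => by simpa [ha'] using hx i hi⟩
end
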